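/- Let Ω ⊂ ℂ be a bounded simply connected domain whose boundary is a Jordan curve that is locally the graph of a Lipschitz function, and let 0 < α < 1. If u ∈ C^{0,α}(bΩ), then u can be written uniquely as u = h + H on bΩ, where h is holomorphic on Ω and extends to a function in C^{0,α}(Ω̄), and H is holomorphic on ℂ ∖ Ω̄, extends to a function in C^{0,α}(ℂ ∖ Ω), and vanishes at infinity. -/

import Mathlib

open Complex MeasureTheory Metric Set Filter
open scoped ENNReal NNReal Topology

noncomputable section

/-- `Ω` is a bounded simply connected Jordan domain whose boundary is the Jordan curve
parametrized (counterclockwise, in a bi-Lipschitz fashion) by `γ` on `[0,1]`, and the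
boundary is locally the graph of a Lipschitz function. -/
structure LipschitzJordanDomain (Ω : Set ℂ) (γ : ℝ → ℂ) : Prop where
  isOpen : IsOpen Ω
  bounded : Bornology.IsBounded Ω
  nonempty : Ω.Nonempty
  simplyConnected : SimplyConnectedSpace Ω
  closedCurve : γ 0 = γ 1
  injOn : InjOn γ (Ico 0 1)
  image : γ '' (Icc 0 1) = frontier Ω
  lipschitz : ∃ K : ℝ≥0, LipschitzOnWith K γ (Icc 0 1)
  biLip : ∃ c > 0, ∀ s ∈ Icc (0:ℝ) 1, ∀ t ∈ Icc (0:ℝ) 1,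
      c * min |s - t| (1 - |s - t|) ≤ dist (γ s) (γ t)
  orientation : ∀ z ∈ Ω,
      (2 * Real.pi * I)⁻¹ * ∫ t in (0:ℝ)..1, deriv γ t / (γ t - z) = 1
  lipGraph : ∀ q ∈ frontier Ω, ∃ θ : ℝ, ∃ φ : ℝ → ℝ, ∃ K : ℝ≥0, ∃ R ∈ 𝓝 q,
      LipschitzWith K φ ∧
      R ∩ Ω = R ∩ {z : ℂ | φ ((Complex.exp (-(θ:ℂ) * I) * z).re)
        < (Complex.exp (-(θ:ℂ) * I) * z).im}

/-- boundary integral of a rectangle -/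
def rectI (f : ℂ → ℂ) (a b c d : ℝ) : ℂ :=
  (∫ x : ℝ in a..b, f (x + c * I)) - (∫ x : ℝ in a..b, f (x + d * I)) +
      I * (∫ y : ℝ in c..d, f (b + y * I)) - I * (∫ y : ℝ in c..d, f (a + y * I))

theorem cont_h {f : ℂ → ℂ} (hf : Continuous f) (c a b : ℝ) :
    IntervalIntegrable (fun x : ℝ => f (x + c * I)) volume a b :=
  Continuous.intervalIntegrable (by fun_prop) _ _

theorem cont_v {f : ℂ → ℂ} (hf : Continuous f) (c a b : ℝ) :
    IntervalIntegrable (fun y : ℝ => f (c + y * I)) volume a b :=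
  Continuous.intervalIntegrable (by fun_prop) _ _

theorem rectI_add_x {f : ℂ → ℂ} (hf : Continuous f) (a b e c d : ℝ) :
    rectI f a e c d = rectI f a b c d + rectI f b e c d := by
  unfold rectI
  rw [← intervalIntegral.integral_add_adjacent_intervals (cont_h hf c a b) (cont_h hf c b e),
    ← intervalIntegral.integral_add_adjacent_intervals (cont_h hf d a b) (cont_h hf d b e)]
  ring

theorem rectI_add_y {f : ℂ → ℂ} (hf : Continuous f) (a b c d e : ℝ) :
    rectI f a b c e = rectI f a b c d + rectI f a b d e := by
  unfold rectI
  rw [← intervalIntegral.integral_add_adjacent_intervals (cont_v hf a c d) (cont_v hf a d e),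
    ← intervalIntegral.integral_add_adjacent_intervals (cont_v hf b c d) (cont_v hf b d e)]
  ring

theorem rectI_bound {f : ℂ → ℂ} (hf : Continuous f) {a b c d : ℝ} (hab : a ≤ b) (hcd : c ≤ d)
    (v : ℂ) (ε : ℝ) (h : ∀ x ∈ Icc a b, ∀ y ∈ Icc c d, ‖f (x + y * I) - v‖ ≤ ε) :
    ‖rectI f a b c d‖ ≤ ε * (2 * (b - a) + 2 * (d - c)) := by
  have key : rectI f a b c d = (∫ x : ℝ in a..b, (f (x + c * I) - v))
      - (∫ x : ℝ in a..b, (f (x + d * I) - v)) +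
      I * (∫ y : ℝ in c..d, (f (b + y * I) - v)) - I * (∫ y : ℝ in c..d, (f (a + y * I) - v)) := by
    unfold rectI
    rw [intervalIntegral.integral_sub (cont_h hf _ _ _) (by simp),
      intervalIntegral.integral_sub (cont_h hf _ _ _) (by simp),
      intervalIntegral.integral_sub (cont_v hf _ _ _) (by simp),
      intervalIntegral.integral_sub (cont_v hf _ _ _) (by simp)]
    ring
  have h1 : ‖∫ x : ℝ in a..b, (f (x + c * I) - v)‖ ≤ ε * |b - a| :=
    intervalIntegral.norm_integral_le_of_norm_le_const fun x hx => by
      rw [uIoc_of_le hab] at hx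
      exact h x ⟨hx.1.le, hx.2⟩ c ⟨le_rfl, hcd⟩
  have h2 : ‖∫ x : ℝ in a..b, (f (x + d * I) - v)‖ ≤ ε * |b - a| :=
    intervalIntegral.norm_integral_le_of_norm_le_const fun x hx => by
      rw [uIoc_of_le hab] at hx
      exact h x ⟨hx.1.le, hx.2⟩ d ⟨hcd, le_rfl⟩
  have h3 : ‖∫ y : ℝ in c..d, (f (b + y * I) - v)‖ ≤ ε * |d - c| :=
    intervalIntegral.norm_integral_le_of_norm_le_const fun y hy => by
      rw [uIoc_of_le hcd] at hy
      exact h b ⟨hab, le_rfl⟩ y ⟨hy.1.le, hy.2⟩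
  have h4 : ‖∫ y : ℝ in c..d, (f (a + y * I) - v)‖ ≤ ε * |d - c| :=
    intervalIntegral.norm_integral_le_of_norm_le_const fun y hy => by
      rw [uIoc_of_le hcd] at hy
      exact h a ⟨le_rfl, hab⟩ y ⟨hy.1.le, hy.2⟩
  rw [abs_of_nonneg (by linarith)] at h1 h2 h3 h4
  rw [key]
  refine (norm_sub_le _ _).trans ?_
  refine (add_le_add_left (norm_add_le _ _) _).trans ?_
  refine (add_le_add_left (add_le_add_left (norm_sub_le _ _) _) _).trans ?_
  simp only [norm_mul, norm_I, one_mul]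
  linarith

theorem rectI_zero {f : ℂ → ℂ} (hf : Continuous f) {a b c d : ℝ} (hab : a ≤ b) (hcd : c ≤ d)
    (h : ∀ x ∈ Ioo a b, ∀ y ∈ Ioo c d, DifferentiableAt ℂ f (x + y * I)) :
    rectI f a b c d = 0 := by
  have := integral_boundary_rect_eq_zero_of_continuousOn_of_differentiableOn f (a + c * I)
    (b + d * I) hf.continuousOn (fun z hz => by
      simp [hab, hcd, mem_reProdIm] at hz
      have := h z.re hz.1 z.im hz.2
      rw [re_add_im] at this
      exact this.differentiableWithinAt)
  simpa [rectI] using this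

theorem clamp_sub_le (c d s t : ℝ) (hst : s ≤ t) :
    max c (min d t) - max c (min d s) ≤ t - s := by
  rcases le_total d t with h1 | h1 <;> rcases le_total d s with h2 | h2 <;>
  rcases max_cases c (min d t) with ⟨h3, h4⟩ | ⟨h3, h4⟩ <;>
  rcases max_cases c (min d s) with ⟨h5, h6⟩ | ⟨h5, h6⟩ <;>
  simp only [min_eq_left h1, min_eq_right h1, min_eq_left h2, min_eq_right h2] at * <;> linarith

theorem rectI_graph {f : ℂ → ℂ} (hf : Continuous f) {φ : ℝ → ℝ} {K : ℝ≥0}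
    (hφ : LipschitzWith K φ) {a b c d : ℝ} (hab : a ≤ b) (hcd : c ≤ d)
    (h : ∀ x ∈ Icc a b, ∀ y ∈ Icc c d, y ≠ φ x → DifferentiableAt ℂ f (x + y * I)) :
    rectI f a b c d = 0 := by
  have hFc : Continuous (fun x : ℝ => rectI f a x c d) := by
    unfold rectI
    have h1 : Continuous fun x : ℝ => ∫ y : ℝ in c..d, f (x + y * I) :=
      intervalIntegral.continuous_parametric_intervalIntegral_of_continuous' (by fun_prop) _ _
    have h2 := intervalIntegral.continuous_primitive (fun a b => cont_h hf c a b) a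
    have h3 := intervalIntegral.continuous_primitive (fun a b => cont_h hf d a b) a
    fun_prop
  have key := constant_of_has_deriv_right_zero (f := fun x : ℝ => rectI f a x c d) (a := a) (b := b)
    hFc.continuousOn ?_ b ⟨hab, le_rfl⟩
  · simp only [key]
    simp [rectI]
  intro x hx
  rw [hasDerivWithinAt_iff_isLittleO, Asymptotics.isLittleO_iff]
  intro ε hε
  set p : ℝ := max c (min d (φ x)) with hp
  have hcp : ContinuousAt f (x + p * I) := hf.continuousAt
  set M : ℝ := 2 + 4 * (K:ℝ) with hM
  have hMpos : 0 < M := by positivity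
  obtain ⟨η, hη, hη'⟩ := Metric.continuousAt_iff.1 hcp (ε / M) (by positivity)
  have : Ico x (min b (x + η / M)) ∈ 𝓝[Ici x] x :=
    Ico_mem_nhdsGE (lt_min hx.2 (by simp; positivity))
  filter_upwards [this] with y hy
  have hyb : y < b := lt_of_lt_of_le hy.2 (min_le_left _ _)
  have hyη : y < x + η / M := lt_of_lt_of_le hy.2 (min_le_right _ _)
  set δ := y - x with hδ
  have hδ0 : 0 ≤ δ := by linarith [hy.1]
  have hδη : M * δ < η := by
    have : δ < η / M := by linarith
    rwa [lt_div_iff₀ hMpos, mul_comm] at this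
  have hKδ : 0 ≤ K * δ := by positivity
  set c1 : ℝ := max c (min d (φ x - K * δ)) with hc1
  set c2 : ℝ := max c (min d (φ x + K * δ)) with hc2
  have hc1c : c ≤ c1 := le_max_left _ _
  have hc2d : c2 ≤ d := max_le hcd (min_le_left _ _)
  have h1p : c1 ≤ p := max_le_max le_rfl (min_le_min le_rfl (by linarith))
  have hp2 : p ≤ c2 := max_le_max le_rfl (min_le_min le_rfl (by linarith))
  have h1p' : p - c1 ≤ K * δ := (clamp_sub_le c d _ _ (by linarith)).trans (by linarith)
  have hp2' : c2 - p ≤ K * δ := (clamp_sub_le c d _ _ (by linarith)).trans (by linarith)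
  have hlip : ∀ t ∈ Icc x y, |φ t - φ x| ≤ K * δ := by
    intro t ht
    have := hφ.dist_le_mul t x
    rw [Real.dist_eq, Real.dist_eq, abs_of_nonneg (by linarith [ht.1] : 0 ≤ t - x)] at this
    exact this.trans (mul_le_mul_of_nonneg_left (by linarith [ht.2]) K.2)
  have hmid : ‖rectI f x y c1 c2‖ ≤ ε / M * (2 * (y - x) + 2 * (c2 - c1)) := by
    refine rectI_bound hf hy.1 (h1p.trans hp2) (f (x + p * I)) _ fun s hs t ht => ?_
    rw [← dist_eq_norm]
    refine (hη' ?_).le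
    rw [dist_eq_norm]
    have : (s + t * I - (x + p * I) : ℂ) = ((s - x : ℝ) : ℂ) + ((t - p : ℝ) : ℂ) * I := by
      push_cast; ring
    rw [this]
    refine (norm_add_le _ _).trans_lt ?_
    simp only [norm_mul, norm_I, mul_one, Complex.norm_real, Real.norm_eq_abs]
    have h1 : |s - x| ≤ δ := abs_le.2 ⟨by linarith [hs.1], by linarith [hs.2]⟩
    have h2 : |t - p| ≤ K * δ := abs_le.2 ⟨by linarith [ht.1], by linarith [ht.2]⟩
    nlinarith
  have hlow : rectI f x y c c1 = 0 := by
    refine rectI_zero hf hy.1 hc1c fun s hs t ht => ?_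
    refine h s ⟨hx.1.trans hs.1.le, (hs.2.trans hyb).le⟩ t ⟨ht.1.le, by linarith [ht.2]⟩ ?_
    have h1 := abs_le.1 (hlip s ⟨hs.1.le, hs.2.le⟩)
    have h2 := ht.2
    rw [hc1] at h2
    rcases lt_max_iff.1 h2 with h3 | h3
    · linarith [ht.1]
    · have := lt_of_lt_of_le h3 (min_le_right _ _)
      intro h4; linarith
  have hhigh : rectI f x y c2 d = 0 := by
    refine rectI_zero hf hy.1 hc2d fun s hs t ht => ?_
    refine h s ⟨hx.1.trans hs.1.le, (hs.2.trans hyb).le⟩ t ⟨by linarith [ht.1], ht.2.le⟩ ?_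
    have h1 := abs_le.1 (hlip s ⟨hs.1.le, hs.2.le⟩)
    have h2 := (max_lt_iff.1 ht.1).2
    rcases min_lt_iff.1 h2 with h3 | h3
    · linarith [ht.2]
    · intro h4; linarith
  have e1 : rectI f a y c d - rectI f a x c d = rectI f x y c1 c2 := by
    rw [rectI_add_x hf a x y, rectI_add_y hf x y c c1 d, rectI_add_y hf x y c1 c2 d, hlow, hhigh]
    ring
  simp only [smul_zero, sub_zero]
  rw [e1, Real.norm_of_nonneg (by linarith)]
  refine hmid.trans ?_
  calc ε / M * (2 * (y - x) + 2 * (c2 - c1)) ≤ ε / M * (M * δ) := by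
        apply mul_le_mul_of_nonneg_left _ (by positivity)
        rw [hM]; linarith
    _ = ε * (y - x) := by field_simp; rfl

theorem painleve_graph {f : ℂ → ℂ} (hf : Continuous f) {φ : ℝ → ℝ} {K : ℝ≥0}
    (hφ : LipschitzWith K φ) {q : ℂ} {r : ℝ}
    (h : ∀ z ∈ ball q r, z.im ≠ φ z.re → DifferentiableAt ℂ f z) :
    DifferentiableOn ℂ f (ball q r) := by
  refine (isConservativeOn_and_continuousOn_iff_isDifferentiableOn isOpen_ball).1
    ⟨?_, hf.continuousOn⟩
  intro z w hzw
  rw [← add_eq_zero_iff_eq_neg, wedgeIntegral_add_wedgeIntegral_eq]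
  change rectI f z.re w.re z.im w.im = 0
  have hd : ∀ x ∈ uIcc z.re w.re, ∀ y ∈ uIcc z.im w.im, y ≠ φ x →
      DifferentiableAt ℂ f (x + y * I) := by
    intro x hx y hy hxy
    refine h _ (hzw ?_) (by simpa using hxy)
    simp [Rectangle, mem_reProdIm, hx, hy]
  have sx : ∀ a b c d : ℝ, rectI f a b c d = - rectI f b a c d := by
    intro a b c d
    unfold rectI
    rw [intervalIntegral.integral_symm b a, intervalIntegral.integral_symm b a]
    ring
  have sy : ∀ a b c d : ℝ, rectI f a b c d = - rectI f a b d c := by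
    intro a b c d
    unfold rectI
    rw [intervalIntegral.integral_symm d c, intervalIntegral.integral_symm d c]
    ring
  rcases le_total z.re w.re with h1 | h1 <;> rcases le_total z.im w.im with h2 | h2
  · rw [uIcc_of_le h1, uIcc_of_le h2] at hd
    exact rectI_graph hf hφ h1 h2 hd
  · rw [uIcc_of_le h1, uIcc_of_ge h2] at hd
    rw [sy, rectI_graph hf hφ h1 h2 hd, neg_zero]
  · rw [uIcc_of_ge h1, uIcc_of_le h2] at hd
    rw [sx, rectI_graph hf hφ h1 h2 hd, neg_zero]
  · rw [uIcc_of_ge h1, uIcc_of_ge h2] at hd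
    rw [sx, sy, rectI_graph hf hφ h1 h2 hd]; simp

/-- rotated version -/
theorem painleve_rot {f : ℂ → ℂ} (hf : Continuous f) {φ : ℝ → ℝ} {K : ℝ≥0}
    (hφ : LipschitzWith K φ) {q e : ℂ} (he : ‖e‖ = 1) {r : ℝ}
    (h : ∀ z ∈ ball q r, (e * z).im ≠ φ (e * z).re → DifferentiableAt ℂ f z) :
    DifferentiableOn ℂ f (ball q r) := by
  have he0 : e ≠ 0 := by rintro rfl; simp at he
  have key : DifferentiableOn ℂ (fun z => f (e⁻¹ * z)) (ball (e * q) r) := by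
    refine painleve_graph (by fun_prop) hφ fun z hz hz' => ?_
    have h1 : DifferentiableAt ℂ f (e⁻¹ * z) := by
      apply h
      · rw [mem_ball, dist_eq_norm] at hz ⊢
        have : z - e * q = e * (e⁻¹ * z - q) := by field_simp
        rwa [this, norm_mul, he, one_mul] at hz
      · rwa [mul_inv_cancel_left₀ he0]
    exact DifferentiableAt.comp z h1 (by fun_prop)
  have : f = (fun z => f (e⁻¹ * z)) ∘ (fun z => e * z) := by
    ext z; simp [inv_mul_cancel_left₀ he0]
  rw [this]
  refine key.comp (by fun_prop) fun z hz => ?_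
  rw [mem_ball, dist_eq_norm] at hz ⊢
  rwa [← mul_sub, norm_mul, he, one_mul]

/-- Cauchy type integrals are holomorphic off the curve. -/
theorem cauchy_hasDerivAt {μ : Measure ℝ} {γ m : ℝ → ℂ} (hm : Integrable m μ)
    (hγ : AEStronglyMeasurable γ μ) {z : ℂ} {r : ℝ} (hr : 0 < r)
    (h : ∀ᵐ t ∂μ, r ≤ ‖γ t - z‖) :
    HasDerivAt (fun z => ∫ t, m t / (γ t - z) ∂μ) (∫ t, m t / (γ t - z) ^ 2 ∂μ) z := by
  have hmeas : ∀ w, AEStronglyMeasurable (fun t => m t / (γ t - w)) μ := fun w =>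
    hm.1.div₀ (hγ.sub aestronglyMeasurable_const)
  have hlow : ∀ᵐ t ∂μ, ∀ w ∈ ball z (r / 2), r / 2 ≤ ‖γ t - w‖ := by
    filter_upwards [h] with t ht w hw
    have h1 : ‖γ t - z‖ ≤ ‖γ t - w‖ + ‖w - z‖ := norm_sub_le_norm_sub_add_norm_sub _ _ _
    rw [mem_ball, dist_eq_norm] at hw
    linarith
  refine (hasDerivAt_integral_of_dominated_loc_of_deriv_le (μ := μ)
    (F := fun w t => m t / (γ t - w)) (F' := fun w t => m t / (γ t - w) ^ 2)
    (bound := fun t => ‖m t‖ * (r / 2)⁻¹ ^ 2)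
    (ball_mem_nhds z (half_pos hr)) (Eventually.of_forall hmeas) ?_
    (hm.1.div₀ ((hγ.sub aestronglyMeasurable_const).pow 2)) ?_ (hm.norm.mul_const _) ?_).2
  · refine (hm.norm.mul_const (r⁻¹)).mono' (hmeas z) ?_
    filter_upwards [h] with t ht
    rw [norm_div, div_eq_mul_inv]
    gcongr
  · filter_upwards [hlow] with t ht w hw
    rw [norm_div, norm_pow, div_eq_mul_inv, ← inv_pow]
    have := ht w hw
    gcongr
  · filter_upwards [hlow] with t ht w hw
    have h1 : γ t - w ≠ 0 := by
      have := ht w hw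
      intro h0
      rw [h0, norm_zero] at this
      linarith
    have := (hasDerivAt_const w (m t)).div ((hasDerivAt_id w).const_sub (γ t)) h1
    have e : (0 * (γ t - id w) - m t * -1) / (γ t - id w) ^ 2 = m t / (γ t - w) ^ 2 := by
      simp
    rw [e] at this
    exact this

theorem cauchy_tendsto {μ : Measure ℝ} {γ m : ℝ → ℂ} (hm : Integrable m μ)
    {B : ℝ} (h : ∀ᵐ t ∂μ, ‖γ t‖ ≤ B) :
    Tendsto (fun z => ∫ t, m t / (γ t - z) ∂μ) (cocompact ℂ) (𝓝 0) := by
  have hB : Tendsto (fun z : ℂ => (∫ t, ‖m t‖ ∂μ) * (‖z‖ - B)⁻¹) (cocompact ℂ) (𝓝 0) := by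
    rw [← mul_zero (∫ t, ‖m t‖ ∂μ)]
    refine Tendsto.const_mul _ (tendsto_inv_atTop_zero.comp ?_)
    exact tendsto_atTop_add_const_right _ _ (tendsto_norm_cocompact_atTop (E := ℂ))
  refine squeeze_zero_norm' ?_ hB
  filter_upwards [(tendsto_norm_cocompact_atTop (E := ℂ)).eventually_gt_atTop B] with z hz
  rw [← integral_mul_const]
  refine norm_integral_le_of_norm_le (hm.norm.mul_const _) ?_
  filter_upwards [h] with t ht
  rw [norm_div, div_eq_mul_inv]
  have : ‖z‖ - B ≤ ‖γ t - z‖ := by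
    have := norm_sub_norm_le z (γ t)
    rw [norm_sub_rev] at this
    linarith
  have h0 : 0 < ‖z‖ - B := by linarith
  gcongr

/-- FTC for Lipschitz complex valued functions -/
theorem ftc_lip {g : ℝ → ℂ} {K : ℝ≥0} (hg : LipschitzOnWith K g (Icc 0 1)) :
    ∫ t in Ioo (0:ℝ) 1, deriv g t = g 1 - g 0 := by
  have hdiff : ∀ᵐ t ∂(volume.restrict (Ioo (0:ℝ) 1)), DifferentiableAt ℝ g t := by
    have := hg.ae_differentiableWithinAt_of_mem (μ := volume)
    filter_upwards [ae_restrict_of_ae this, ae_restrict_mem measurableSet_Ioo] with t h1 ht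
    exact (h1 (Ioo_subset_Icc_self ht)).differentiableAt (Icc_mem_nhds ht.1 ht.2)
  have hbd : ∀ᵐ t ∂(volume.restrict (Ioo (0:ℝ) 1)), ‖deriv g t‖ ≤ K := by
    filter_upwards [ae_restrict_mem measurableSet_Ioo] with t ht
    exact norm_deriv_le_of_lipschitzOn (Icc_mem_nhds ht.1 ht.2) hg
  have hintg : Integrable (deriv g) (volume.restrict (Ioo (0:ℝ) 1)) :=
    Integrable.of_bound (stronglyMeasurable_deriv g).aestronglyMeasurable _ hbd
  have h01 : uIcc (0:ℝ) 1 = Icc 0 1 := uIcc_of_le zero_le_one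
  have hre : AbsolutelyContinuousOnInterval (fun t => (g t).re) 0 1 := by
    apply LipschitzOnWith.absolutelyContinuousOnInterval (K := K)
    rw [h01]
    refine LipschitzOnWith.of_dist_le_mul fun x hx y hy => ?_
    refine le_trans ?_ (hg.dist_le_mul x hx y hy)
    rw [Real.dist_eq, dist_eq_norm, ← sub_re]
    exact abs_re_le_norm _
  have him : AbsolutelyContinuousOnInterval (fun t => (g t).im) 0 1 := by
    apply LipschitzOnWith.absolutelyContinuousOnInterval (K := K)
    rw [h01]
    refine LipschitzOnWith.of_dist_le_mul fun x hx y hy => ?_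
    refine le_trans ?_ (hg.dist_le_mul x hx y hy)
    rw [Real.dist_eq, dist_eq_norm, ← sub_im]
    exact abs_im_le_norm _
  have h1 := hre.integral_deriv_eq_sub
  have h2 := him.integral_deriv_eq_sub
  rw [intervalIntegral.integral_of_le zero_le_one, integral_Ioc_eq_integral_Ioo] at h1 h2
  apply Complex.ext
  · have : (∫ t in Ioo (0:ℝ) 1, deriv g t).re = ∫ t in Ioo (0:ℝ) 1, (deriv g t).re := by
      have := integral_re hintg
      exact this.symm
    rw [this, sub_re, ← h1]
    apply integral_congr_ae
    filter_upwards [hdiff] with t ht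
    exact (((reCLM.hasFDerivAt).comp_hasDerivAt t ht.hasDerivAt).deriv).symm
  · have : (∫ t in Ioo (0:ℝ) 1, deriv g t).im = ∫ t in Ioo (0:ℝ) 1, (deriv g t).im := by
      have := integral_im hintg
      exact this.symm
    rw [this, sub_im, ← h2]
    apply integral_congr_ae
    filter_upwards [hdiff] with t ht
    exact (((imCLM.hasFDerivAt).comp_hasDerivAt t ht.hasDerivAt).deriv).symm

/-- The parameter measure. -/
abbrev pm : Measure ℝ := volume.restrict (Ioo (0:ℝ) 1)

namespace LipschitzJordanDomain
variable {Ω : Set ℂ} {γ : ℝ → ℂ}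

theorem contOn (h : LipschitzJordanDomain Ω γ) : ContinuousOn γ (Icc 0 1) := by
  obtain ⟨K, hK⟩ := h.lipschitz
  exact hK.continuousOn

theorem aesm (h : LipschitzJordanDomain Ω γ) : AEStronglyMeasurable γ pm :=
  (h.contOn.mono Ioo_subset_Icc_self).aestronglyMeasurable measurableSet_Ioo

theorem deriv_bound (h : LipschitzJordanDomain Ω γ) :
    ∃ K : ℝ, 0 < K ∧ ∀ t ∈ Ioo (0:ℝ) 1, ‖deriv γ t‖ ≤ K := by
  obtain ⟨K, hK⟩ := h.lipschitz
  refine ⟨K + 1, by positivity, fun t ht => ?_⟩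
  have := norm_deriv_le_of_lipschitzOn (Icc_mem_nhds ht.1 ht.2) hK
  linarith

theorem mem_frontier (h : LipschitzJordanDomain Ω γ) {t : ℝ} (ht : t ∈ Icc (0:ℝ) 1) :
    γ t ∈ frontier Ω := h.image ▸ mem_image_of_mem _ ht

theorem frontier_compact (h : LipschitzJordanDomain Ω γ) : IsCompact (frontier Ω) := by
  rw [← h.image]; exact isCompact_Icc.image_of_continuousOn h.contOn

theorem frontier_nonempty (h : LipschitzJordanDomain Ω γ) : (frontier Ω).Nonempty :=
  ⟨_, h.mem_frontier (t := 0) (by simp)⟩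

theorem deriv_int (h : LipschitzJordanDomain Ω γ) : Integrable (deriv γ) pm := by
  obtain ⟨K, _, hK⟩ := h.deriv_bound
  refine Integrable.of_bound (stronglyMeasurable_deriv γ).aestronglyMeasurable K ?_
  filter_upwards [ae_restrict_mem measurableSet_Ioo] with t ht using hK t ht

theorem off (h : LipschitzJordanDomain Ω γ) {z : ℂ} (hz : z ∉ frontier Ω) :
    ∃ r > 0, ∀ t ∈ Icc (0:ℝ) 1, r ≤ ‖γ t - z‖ := by
  refine ⟨infDist z (frontier Ω), ?_, fun t ht => ?_⟩
  · exact (isClosed_frontier.notMem_iff_infDist_pos h.frontier_nonempty).1 hz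
  · rw [← dist_eq_norm, dist_comm]
    exact infDist_le_dist_of_mem (h.mem_frontier ht)

theorem wind_one (h : LipschitzJordanDomain Ω γ) {z : ℂ} (hz : z ∈ Ω) :
    (2 * Real.pi * I)⁻¹ * ∫ t, deriv γ t / (γ t - z) ∂pm = 1 := by
  rw [← h.orientation z hz, intervalIntegral.integral_of_le zero_le_one,
    integral_Ioc_eq_integral_Ioo]

theorem wind_deriv (h : LipschitzJordanDomain Ω γ) {z : ℂ} (hz : z ∉ frontier Ω) :
    HasDerivAt (fun z => ∫ t, deriv γ t / (γ t - z) ∂pm) 0 z := by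
  obtain ⟨r, hr, hr'⟩ := h.off hz
  have h1 := cauchy_hasDerivAt h.deriv_int h.aesm hr (z := z) (by
    filter_upwards [ae_restrict_mem measurableSet_Ioo] with t ht
      using hr' t (Ioo_subset_Icc_self ht))
  convert h1 using 1
  symm
  obtain ⟨K, hK⟩ := h.lipschitz
  have hne : ∀ t ∈ Icc (0:ℝ) 1, γ t - z ≠ 0 := fun t ht h0 => by
    have := hr' t ht
    rw [h0, norm_zero] at this
    linarith
  have hlip : LipschitzOnWith (K * (Real.toNNReal r)⁻¹ ^ 2) (fun t => -(γ t - z)⁻¹) (Icc 0 1) := by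
    refine LipschitzOnWith.of_dist_le_mul fun s hs t ht => ?_
    have h2 : -(γ s - z)⁻¹ - -(γ t - z)⁻¹ = (γ s - γ t) * ((γ s - z)⁻¹ * (γ t - z)⁻¹) := by
      have := hne s hs
      have := hne t ht
      field_simp; ring
    rw [dist_eq_norm, h2, norm_mul, norm_mul, norm_inv, norm_inv]
    have h3 := hK.dist_le_mul s hs t ht
    rw [dist_eq_norm] at h3
    have h4 := hr' s hs
    have h5 := hr' t ht
    calc _ ≤ (K * dist s t) * (r⁻¹ * r⁻¹) := by gcongr
      _ = _ := by push_cast; rw [Real.coe_toNNReal r hr.le]; ring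
  have h2 := ftc_lip hlip
  rw [h.closedCurve, sub_self] at h2
  rw [← h2]
  apply integral_congr_ae
  have hd := hK.ae_differentiableWithinAt_of_mem (μ := volume)
  filter_upwards [ae_restrict_of_ae hd, ae_restrict_mem measurableSet_Ioo] with t h1 ht
  have h3 := (h1 (Ioo_subset_Icc_self ht)).differentiableAt (Icc_mem_nhds ht.1 ht.2)
  have h4 := ((h3.hasDerivAt.sub_const z).fun_inv (hne t (Ioo_subset_Icc_self ht))).fun_neg
  rw [h4.deriv]
  ring

/-- Local graph description. -/
theorem local_graph (h : LipschitzJordanDomain Ω γ) {q : ℂ} (hq : q ∈ frontier Ω) :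
    ∃ e : ℂ, ‖e‖ = 1 ∧ ∃ φ : ℝ → ℝ, ∃ K : ℝ≥0, LipschitzWith K φ ∧ ∃ ρ > 0,
      ∀ p ∈ ball q ρ, (φ (e * p).re < (e * p).im → p ∈ Ω) ∧
        ((e * p).im < φ (e * p).re → p ∈ (closure Ω)ᶜ) ∧
        (p ∈ frontier Ω → (e * p).im = φ (e * p).re) := by
  obtain ⟨θ, φ, K, R, hR, hφ, hRe⟩ := h.lipGraph q hq
  refine ⟨Complex.exp (-(θ:ℂ) * I), ?_, φ, K, hφ, ?_⟩
  · have := Complex.norm_exp_ofReal_mul_I (-θ)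
    simpa using this
  set e := Complex.exp (-(θ:ℂ) * I)
  obtain ⟨ρ, hρ, hρR⟩ := Metric.mem_nhds_iff.1 hR
  have hiff : ∀ p ∈ ball q ρ, p ∈ Ω ↔ φ (e * p).re < (e * p).im := by
    intro p hp
    have h1 : p ∈ R ∩ Ω ↔ p ∈ R ∩ {z : ℂ | φ (e * z).re < (e * z).im} := by rw [hRe]
    simpa [hρR hp] using h1
  have hφc := hφ.continuous
  have hext : ∀ p ∈ ball q ρ, (e * p).im < φ (e * p).re → p ∈ (closure Ω)ᶜ := by
    intro p hp hlt
    rw [mem_compl_iff, _root_.mem_closure_iff]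
    push Not
    refine ⟨ball q ρ ∩ {z : ℂ | (e * z).im < φ (e * z).re},
      isOpen_ball.inter (isOpen_lt (by fun_prop) (by fun_prop)), ⟨hp, hlt⟩, ?_⟩
    rw [← Set.not_nonempty_iff_eq_empty]
    rintro ⟨z, ⟨hz1, hz2⟩, hz3⟩
    have := (hiff z hz1).1 hz3
    change (e * z).im < φ (e * z).re at hz2
    linarith
  refine ⟨ρ, hρ, fun p hp => ⟨(hiff p hp).2, hext p hp, fun hpf => ?_⟩⟩
  rw [h.isOpen.frontier_eq] at hpf
  rcases lt_trichotomy (e * p).im (φ (e * p).re) with h1 | h1 | h1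
  · exact absurd hpf.1 (hext p hp h1)
  · exact h1
  · exact absurd ((hiff p hp).2 h1) hpf.2

/-- Abstract local description with a defining function. -/
theorem local_def (h : LipschitzJordanDomain Ω γ) {q : ℂ} (hq : q ∈ frontier Ω) :
    ∃ g : ℂ → ℝ, ∃ ν : ℂ, ‖ν‖ = 1 ∧ ∃ L : ℝ, 1 ≤ L ∧
      (∀ p p', |g p - g p'| ≤ L * ‖p - p'‖) ∧
      (∀ p (t : ℝ), g (p + t * ν) = g p + t) ∧ ∃ ρ > 0,
      ∀ p ∈ ball q ρ, (0 < g p → p ∈ Ω) ∧ (g p < 0 → p ∈ (closure Ω)ᶜ) ∧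
        (p ∈ frontier Ω → g p = 0) := by
  obtain ⟨e, he, φ, K, hφ, ρ, hρ, H⟩ := h.local_graph hq
  have he0 : e ≠ 0 := by rintro rfl; simp at he
  refine ⟨fun p => (e * p).im - φ (e * p).re, e⁻¹ * I, by simp [he], 1 + K, by simp, ?_, ?_,
    ρ, hρ, fun p hp => ⟨fun h1 => (H p hp).1 (by linarith), fun h1 => (H p hp).2.1 (by linarith),
      fun h1 => sub_eq_zero.2 ((H p hp).2.2 h1)⟩⟩
  · intro p p'
    have h1 : |(e * p).im - (e * p').im| ≤ ‖p - p'‖ := by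
      rw [← sub_im, ← mul_sub]
      refine (abs_im_le_norm _).trans ?_
      rw [norm_mul, he, one_mul]
    have h2 : |(e * p).re - (e * p').re| ≤ ‖p - p'‖ := by
      rw [← sub_re, ← mul_sub]
      refine (abs_re_le_norm _).trans ?_
      rw [norm_mul, he, one_mul]
    have h3 := hφ.dist_le_mul (e * p).re (e * p').re
    rw [Real.dist_eq, Real.dist_eq] at h3
    have h4 : |φ (e * p).re - φ (e * p').re| ≤ K * ‖p - p'‖ :=
      h3.trans (mul_le_mul_of_nonneg_left h2 K.2)
    rw [abs_le] at h1 h4 ⊢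
    constructor <;> linarith
  · intro p t
    have : e * (p + t * (e⁻¹ * I)) = e * p + t * I := by field_simp
    simp only [this]
    simp
    ring

end LipschitzJordanDomain

namespace LipschitzJordanDomain
variable {Ω : Set ℂ} {γ : ℝ → ℂ}

theorem wind_seg (h : LipschitzJordanDomain Ω γ) {p p' : ℂ}
    (hs : segment ℝ p p' ⊆ (frontier Ω)ᶜ) :
    ∫ t, deriv γ t / (γ t - p) ∂pm = ∫ t, deriv γ t / (γ t - p') ∂pm := by
  have := Convex.norm_image_sub_le_of_norm_hasDerivWithin_le (𝕜 := ℂ)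
    (f := fun z => ∫ t, deriv γ t / (γ t - z) ∂pm) (f' := fun _ => 0) (C := 0)
    (s := segment ℝ p p') (fun x hx => (h.wind_deriv (hs hx)).hasDerivWithinAt)
    (by simp) (convex_segment p p') (right_mem_segment ℝ p p') (left_mem_segment ℝ p p')
  rw [zero_mul, norm_le_zero_iff, sub_eq_zero] at this
  exact this

theorem ext_sub (Ω : Set ℂ) : (closure Ω)ᶜ ⊆ (frontier Ω)ᶜ :=
  compl_subset_compl.2 frontier_subset_closure

theorem Om_sub (h : LipschitzJordanDomain Ω γ) : Ω ⊆ (frontier Ω)ᶜ := fun z hz hf => by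
  rw [h.isOpen.frontier_eq] at hf
  exact hf.2 hz

theorem wind_local (h : LipschitzJordanDomain Ω γ) {q : ℂ} (hq : q ∈ frontier Ω) :
    ∃ k : ℂ, ∃ r > 0, ∀ p ∈ ball q r, p ∈ (closure Ω)ᶜ →
      ∫ t, deriv γ t / (γ t - p) ∂pm = k := by
  obtain ⟨g, ν, hν, L, hL, hg, hgν, ρ, hρ, H⟩ := h.local_def hq
  have hgq : g q = 0 := (H q (mem_ball_self hρ)).2.2 hq
  refine ⟨∫ t, deriv γ t / (γ t - (q + ((-(ρ / 2) : ℝ) : ℂ) * ν)) ∂pm, ρ / (2 * L),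
    by positivity, fun p hp hpe => ?_⟩
  have hpq : ‖p - q‖ < ρ / (2 * L) := by rwa [mem_ball, dist_eq_norm] at hp
  have hpq' : L * ‖p - q‖ < ρ / 2 := by
    rw [lt_div_iff₀ (by positivity)] at hpq
    linarith
  have hpq'' : ‖p - q‖ < ρ / 2 := by nlinarith [norm_nonneg (p - q)]
  have hgp : g p < 0 := by
    by_contra hcon
    push Not at hcon
    apply hpe
    have ht : Tendsto (fun t : ℝ => p + t * ν) (𝓝[>] 0) (𝓝 p) := by
      have : Continuous (fun t : ℝ => p + t * ν) := by fun_prop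
      have := this.tendsto 0
      simp only [ofReal_zero, zero_mul, add_zero] at this
      exact this.mono_left nhdsWithin_le_nhds
    refine mem_closure_of_tendsto ht ?_
    have hb : ball q ρ ∈ 𝓝 p := isOpen_ball.mem_nhds (by
      rw [mem_ball, dist_eq_norm]; linarith)
    filter_upwards [ht.eventually hb, self_mem_nhdsWithin] with t ht1 ht2
    apply (H _ ht1).1
    rw [hgν]
    exact add_pos_of_nonneg_of_pos hcon ht2
  have hext : ∀ x, ‖x - q‖ < ρ → g x < 0 → x ∈ (frontier Ω)ᶜ := fun x hx hx' =>
    ext_sub Ω ((H x (by rwa [mem_ball, dist_eq_norm])).2.1 hx')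
  rw [h.wind_seg (p := p) (p' := p + ((-(ρ / 2) : ℝ) : ℂ) * ν), h.wind_seg]
  · intro x hx
    rw [segment_eq_image'] at hx
    obtain ⟨θ, hθ, rfl⟩ := hx
    have e : p + ((-(ρ / 2) : ℝ) : ℂ) * ν + θ • (q + ((-(ρ / 2) : ℝ) : ℂ) * ν -
        (p + ((-(ρ / 2) : ℝ) : ℂ) * ν)) = (q + (1 - θ) * (p - q)) + ((-(ρ / 2) : ℝ) : ℂ) * ν := by
      rw [real_smul]; ring
    simp only [e]
    have hle : ‖(1 - θ : ℂ) * (p - q)‖ ≤ ‖p - q‖ := by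
      rw [norm_mul]
      have : (1 - θ : ℂ) = ((1 - θ : ℝ) : ℂ) := by push_cast; ring
      rw [this, norm_real, Real.norm_of_nonneg (by linarith [hθ.2])]
      exact mul_le_of_le_one_left (norm_nonneg _) (by linarith [hθ.1])
    apply hext
    · have e2 : q + (1 - θ) * (p - q) + ((-(ρ / 2) : ℝ) : ℂ) * ν - q =
        (1 - θ) * (p - q) + ((-(ρ / 2) : ℝ) : ℂ) * ν := by ring
      rw [e2]
      refine (norm_add_le _ _).trans_lt ?_
      rw [norm_mul _ ν, hν, norm_real, Real.norm_eq_abs, abs_neg, abs_of_pos (by positivity)]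
      linarith
    · rw [hgν]
      have h1 := hg (q + (1 - θ) * (p - q)) q
      rw [add_sub_cancel_left, hgq, sub_zero] at h1
      have h2 := (le_abs_self _).trans h1
      have h3 : L * ‖(1 - θ : ℂ) * (p - q)‖ ≤ L * ‖p - q‖ :=
        mul_le_mul_of_nonneg_left hle (by linarith)
      linarith
  · intro x hx
    rw [segment_eq_image'] at hx
    obtain ⟨θ, hθ, rfl⟩ := hx
    have e : p + θ • (p + ((-(ρ / 2) : ℝ) : ℂ) * ν - p) = p + ((-(θ * (ρ / 2)) : ℝ) : ℂ) * ν := by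
      rw [real_smul]; push_cast; ring
    simp only [e]
    have h0 : 0 ≤ θ * (ρ / 2) := mul_nonneg hθ.1 (by positivity)
    have h1 : θ * (ρ / 2) ≤ ρ / 2 := mul_le_of_le_one_left (by positivity) hθ.2
    apply hext
    · rw [add_sub_right_comm]
      refine (norm_add_le _ _).trans_lt ?_
      rw [norm_mul _ ν, hν, norm_real, Real.norm_eq_abs, abs_neg, abs_of_nonneg h0]
      linarith
    · rw [hgν]; linarith

/-- Points on either side at comparable distance. -/
theorem cork_local (h : LipschitzJordanDomain Ω γ) {q : ℂ} (hq : q ∈ frontier Ω) :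
    ∃ r > 0, ∃ c > 0, ∀ p ∈ ball q r, p ∈ frontier Ω → ∀ δ : ℝ, 0 < δ → δ < r →
      (∃ z ∈ Ω, ‖z - p‖ ≤ δ ∧ ∀ x ∈ frontier Ω, c * δ ≤ ‖x - z‖) ∧
      (∃ z ∈ (closure Ω)ᶜ, ‖z - p‖ ≤ δ ∧ ∀ x ∈ frontier Ω, c * δ ≤ ‖x - z‖) := by
  obtain ⟨g, ν, hν, L, hL, hg, hgν, ρ, hρ, H⟩ := h.local_def hq
  refine ⟨ρ / 4, by positivity, 1 / L, by positivity, fun p hp hpf δ hδ hδρ => ?_⟩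
  have hpq : ‖p - q‖ < ρ / 4 := by rwa [mem_ball, dist_eq_norm] at hp
  have hgp : g p = 0 := (H p (by rw [mem_ball, dist_eq_norm]; linarith)).2.2 hpf
  have key : ∀ s : ℝ, |s| = δ → ‖p + s * ν - p‖ ≤ δ ∧ p + s * ν ∈ ball q ρ ∧
      g (p + s * ν) = s ∧ ∀ x ∈ frontier Ω, 1 / L * δ ≤ ‖x - (p + s * ν)‖ := by
    intro s hs
    have h1 : ‖p + s * ν - p‖ = δ := by
      rw [add_sub_cancel_left, norm_mul, hν, norm_real, Real.norm_eq_abs, hs, mul_one]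
    have h2 : ‖p + s * ν - q‖ < ρ / 2 := by
      have := norm_sub_le_norm_sub_add_norm_sub (p + s * ν) p q
      linarith
    have h3 : g (p + s * ν) = s := by rw [hgν, hgp, zero_add]
    refine ⟨h1.le, by rw [mem_ball, dist_eq_norm]; linarith, h3, fun x hx => ?_⟩
    by_cases hxb : x ∈ ball q ρ
    · have h4 := hg x (p + s * ν)
      rw [(H x hxb).2.2 hx, h3, zero_sub, abs_neg, hs] at h4
      rw [one_div, inv_mul_le_iff₀ (by positivity)]
      exact h4
    · rw [mem_ball, not_lt, dist_eq_norm] at hxb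
      have := norm_sub_le_norm_sub_add_norm_sub x (p + s * ν) q
      have h5 : 1 / L * δ ≤ δ := mul_le_of_le_one_left hδ.le (by
        rw [div_le_one (by positivity)]; exact hL)
      linarith
  refine ⟨?_, ?_⟩
  · obtain ⟨h1, h2, h3, h4⟩ := key δ (abs_of_pos hδ)
    exact ⟨_, (H _ h2).1 (by rw [h3]; exact hδ), h1, h4⟩
  · obtain ⟨h1, h2, h3, h4⟩ := key (-δ) (by rw [abs_neg, abs_of_pos hδ])
    exact ⟨_, (H _ h2).2.1 (by rw [h3]; linarith), h1, h4⟩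

theorem cork (h : LipschitzJordanDomain Ω γ) :
    ∃ r > 0, ∃ c > 0, ∀ p ∈ frontier Ω, ∀ δ : ℝ, 0 < δ → δ < r →
      (∃ z ∈ Ω, ‖z - p‖ ≤ δ ∧ ∀ x ∈ frontier Ω, c * δ ≤ ‖x - z‖) ∧
      (∃ z ∈ (closure Ω)ᶜ, ‖z - p‖ ≤ δ ∧ ∀ x ∈ frontier Ω, c * δ ≤ ‖x - z‖) := by
  refine h.frontier_compact.induction_on (p := fun S => ∃ r > 0, ∃ c > 0, ∀ p ∈ S,
      ∀ δ : ℝ, 0 < δ → δ < r →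
      (∃ z ∈ Ω, ‖z - p‖ ≤ δ ∧ ∀ x ∈ frontier Ω, c * δ ≤ ‖x - z‖) ∧
      (∃ z ∈ (closure Ω)ᶜ, ‖z - p‖ ≤ δ ∧ ∀ x ∈ frontier Ω, c * δ ≤ ‖x - z‖)) ?_ ?_ ?_ ?_
  · exact ⟨1, one_pos, 1, one_pos, by simp⟩
  · rintro s t hst ⟨r, hr, c, hc, H⟩
    exact ⟨r, hr, c, hc, fun p hp => H p (hst hp)⟩
  · rintro s t ⟨r, hr, c, hc, H⟩ ⟨r', hr', c', hc', H'⟩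
    refine ⟨min r r', lt_min hr hr', min c c', lt_min hc hc', fun p hp δ hδ hδ' => ?_⟩
    rcases hp with hp | hp
    · obtain ⟨⟨z, h1, h2, h3⟩, ⟨w, h4, h5, h6⟩⟩ := H p hp δ hδ (hδ'.trans_le (min_le_left _ _))
      have : min c c' * δ ≤ c * δ := mul_le_mul_of_nonneg_right (min_le_left _ _) hδ.le
      exact ⟨⟨z, h1, h2, fun x hx => this.trans (h3 x hx)⟩,
        ⟨w, h4, h5, fun x hx => this.trans (h6 x hx)⟩⟩
    · obtain ⟨⟨z, h1, h2, h3⟩, ⟨w, h4, h5, h6⟩⟩ := H' p hp δ hδ (hδ'.trans_le (min_le_right _ _))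
      have : min c c' * δ ≤ c' * δ := mul_le_mul_of_nonneg_right (min_le_right _ _) hδ.le
      exact ⟨⟨z, h1, h2, fun x hx => this.trans (h3 x hx)⟩,
        ⟨w, h4, h5, fun x hx => this.trans (h6 x hx)⟩⟩
  · intro q hq
    obtain ⟨r, hr, c, hc, H⟩ := h.cork_local hq
    exact ⟨ball q r ∩ frontier Ω, inter_mem (mem_nhdsWithin_of_mem_nhds (ball_mem_nhds q hr)) self_mem_nhdsWithin,
      r, hr, c, hc,
      fun p hp => H p hp.1 hp.2⟩

theorem wind_zero (h : LipschitzJordanDomain Ω γ) {z : ℂ} (hz : z ∈ (closure Ω)ᶜ) :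
    ∫ t, deriv γ t / (γ t - z) ∂pm = 0 := by
  classical
  set W : ℂ → ℂ := fun z => ∫ t, deriv γ t / (γ t - z) ∂pm with hW
  have hl : ∀ q : ℂ, ∃ k : ℂ, ∃ r > 0, q ∈ frontier Ω → ∀ p ∈ ball q r, p ∈ (closure Ω)ᶜ →
      W p = k := by
    intro q
    by_cases hq : q ∈ frontier Ω
    · obtain ⟨k, r, hr, H⟩ := h.wind_local hq
      exact ⟨k, r, hr, fun _ => H⟩
    · exact ⟨0, 1, one_pos, fun h => absurd h hq⟩
  choose k r hr hk using hl
  have hkl : ∀ q ∈ frontier Ω, ∀ q' ∈ frontier Ω, q' ∈ ball q (r q) → k q = k q' := by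
    intro q hq q' hq' hqq
    obtain ⟨r0, hr0, c, hc, H⟩ := h.cork
    set δ := min (r0 / 2) (min (r q - dist q' q) (r q') / 2) with hδ
    have hqq' : 0 < r q - dist q' q := by rw [mem_ball] at hqq; linarith
    have hδ0 : 0 < δ := lt_min (by positivity) (half_pos (lt_min hqq' (hr q')))
    have hδ1 : δ < r0 := lt_of_le_of_lt (min_le_left _ _) (by linarith)
    have hm := lt_min hqq' (hr q')
    have hδ2 : δ < min (r q - dist q' q) (r q') :=
      lt_of_le_of_lt (min_le_right _ _) (by linarith)
    obtain ⟨x, hx, hxq, -⟩ := (H q' hq' δ hδ0 hδ1).2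
    have hd : dist x q' ≤ δ := by rwa [dist_eq_norm]
    have h1 := lt_min_iff.1 hδ2
    rw [← hk q hq x (by rw [mem_ball]; linarith [dist_triangle x q' q]) hx,
      ← hk q' hq' x (by rw [mem_ball]; linarith) hx]
  have hpre : IsPreconnected (frontier Ω) := by
    rw [← h.image]; exact isPreconnected_Icc.image _ h.contOn
  obtain ⟨q0, hq0⟩ := h.frontier_nonempty
  have hk0 : ∀ q ∈ frontier Ω, k q = k q0 := fun q hq =>
    hpre.induction₂ (fun x y => k x = k y)
      (fun x hx => by
        filter_upwards [self_mem_nhdsWithin, mem_nhdsWithin_of_mem_nhds (ball_mem_nhds x (hr x))]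
          with y hy hy'
        exact hkl x hx y hy hy')
      (fun x y z _ _ _ h1 h2 => h1.trans h2) (fun x y _ _ h1 => h1.symm) hq hq0
  set F : ℂ → ℂ := fun z => if z ∈ (closure Ω)ᶜ then W z else k q0 with hF
  have hFl : ∀ x y, F x = F y := by
    intro x y
    refine isPreconnected_univ.induction₂ (fun x y => F x = F y) (fun x _ => ?_)
      (fun x y z _ _ _ h1 h2 => h1.trans h2) (fun x y _ _ h1 => h1.symm) (mem_univ x) (mem_univ y)
    rw [nhdsWithin_univ]
    by_cases hx : x ∈ (closure Ω)ᶜ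
    · obtain ⟨ε, hε, hεs⟩ := Metric.isOpen_iff.1 isClosed_closure.isOpen_compl x hx
      filter_upwards [ball_mem_nhds x hε] with y hy
      simp only [hF, if_pos hx, if_pos (hεs hy)]
      exact h.wind_seg (((convex_ball x ε).segment_subset (mem_ball_self hε) hy).trans
        (hεs.trans (ext_sub Ω)))
    · by_cases hxo : x ∈ Ω
      · filter_upwards [h.isOpen.mem_nhds hxo] with y hy
        have hy' : y ∉ (closure Ω)ᶜ := fun h => h (subset_closure hy)
        simp only [hF, if_neg hx, if_neg hy']
      · have hxf : x ∈ frontier Ω := by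
          rw [h.isOpen.frontier_eq]
          exact ⟨not_not.1 hx, hxo⟩
        filter_upwards [ball_mem_nhds x (hr x)] with y hy
        simp only [hF, if_neg hx]
        by_cases hy' : y ∈ (closure Ω)ᶜ
        · rw [if_pos hy', hk x hxf y hy hy', hk0 x hxf]
        · rw [if_neg hy']
  have hlim : Tendsto W (cocompact ℂ) (𝓝 0) := by
    obtain ⟨B, hB⟩ := h.frontier_compact.isBounded.exists_norm_le
    refine cauchy_tendsto h.deriv_int (B := B) ?_
    filter_upwards [ae_restrict_mem measurableSet_Ioo] with t ht
    exact hB _ (h.mem_frontier (Ioo_subset_Icc_self ht))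
  have hlim2 : Tendsto (fun _ : ℂ => F z) (cocompact ℂ) (𝓝 0) := by
    refine hlim.congr' ?_
    have hc : IsCompact (closure Ω) := h.bounded.isCompact_closure
    filter_upwards [hc.compl_mem_cocompact] with x hx
    rw [hFl z x]
    simp only [hF, if_pos hx]
  have := tendsto_nhds_unique tendsto_const_nhds hlim2
  simpa only [hF, if_pos hz] using this

end LipschitzJordanDomain

/-- The kernel controlling all the singular integrals. -/
def kern (a d x : ℝ) : ℝ := x ^ (a - 1) * min 1 (d / x)

theorem kern_anti {a d x y : ℝ} (ha1 : a < 1) (hd : 0 < d) (hx : 0 < x) (hxy : x ≤ y) :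
    kern a d y ≤ kern a d x := by
  have hy := hx.trans_le hxy
  unfold kern
  refine mul_le_mul (Real.rpow_le_rpow_of_nonpos hx hxy (by linarith)) ?_ ?_ ?_
  · exact min_le_min le_rfl (div_le_div_of_nonneg_left hd.le hx hxy)
  · exact le_min zero_le_one (by positivity)
  · positivity

theorem kern_nonneg {a d x : ℝ} (hd : 0 < d) (hx : 0 < x) : 0 ≤ kern a d x :=
  mul_nonneg (by positivity) (le_min zero_le_one (by positivity))

theorem kern_scale {a d x : ℝ} (hd : 0 < d) (hx : 0 < x) :
    kern a d x = d ^ (a - 1) * kern a 1 (x / d) := by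
  unfold kern
  rw [Real.div_rpow hx.le hd.le, one_div_div]
  have : d ^ (a - 1) ≠ 0 := by positivity
  field_simp

/-- The model kernel on the line. -/
def kline (a : ℝ) (x : ℝ) : ℝ :=
  (Ioi (0:ℝ)).indicator (kern a 1) x + (Ioi (0:ℝ)).indicator (kern a 1) (-x)

theorem kline_nonneg (a x : ℝ) : 0 ≤ kline a x :=
  add_nonneg (indicator_nonneg (fun _ hx => kern_nonneg one_pos hx) _)
    (indicator_nonneg (fun _ hx => kern_nonneg one_pos hx) _)

theorem kline_eq {a x : ℝ} (hx : x ≠ 0) : kline a x = kern a 1 |x| := by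
  unfold kline
  rcases lt_or_gt_of_ne hx with h | h
  · rw [indicator_of_notMem (by simpa using h.le), indicator_of_mem (by simpa using h),
      abs_of_neg h, zero_add]
  · rw [indicator_of_mem (by simpa using h), indicator_of_notMem (by simpa using h.le),
      abs_of_pos h, add_zero]

theorem kline_integrable {a : ℝ} (ha0 : 0 < a) (ha1 : a < 1) : Integrable (kline a) := by
  have hmeas : Measurable (kern a 1) := by unfold kern; fun_prop
  have h1 : IntegrableOn (kern a 1) (Ioc 0 1) := by
    have := (intervalIntegral.intervalIntegrable_rpow' (a := 0) (b := 1) (r := a - 1)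
      (by linarith))
    rw [intervalIntegrable_iff_integrableOn_Ioc_of_le zero_le_one] at this
    refine Integrable.mono' this hmeas.aestronglyMeasurable ?_
    filter_upwards [ae_restrict_mem measurableSet_Ioc] with x hx
    rw [Real.norm_of_nonneg (kern_nonneg one_pos hx.1)]
    have h0 : 0 ≤ x ^ (a - 1) := Real.rpow_nonneg hx.1.le _
    exact mul_le_of_le_one_right h0 (min_le_left _ _)
  have h2 : IntegrableOn (kern a 1) (Ioi 1) := by
    have := integrableOn_Ioi_rpow_of_lt (a := a - 2) (c := 1) (by linarith) one_pos
    refine Integrable.mono' this hmeas.aestronglyMeasurable ?_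
    filter_upwards [ae_restrict_mem measurableSet_Ioi] with x hx
    have hx0 : (0:ℝ) < x := one_pos.trans hx
    rw [Real.norm_of_nonneg (kern_nonneg one_pos hx0)]
    have h0 : 0 ≤ x ^ (a - 1) := Real.rpow_nonneg hx0.le _
    refine (mul_le_mul_of_nonneg_left (min_le_right _ _) h0).trans ?_
    rw [mul_one_div, ← Real.rpow_sub_one hx0.ne']
    exact le_of_eq (by ring_nf)
  have h3 : Integrable ((Ioi (0:ℝ)).indicator (kern a 1)) := by
    rw [integrable_indicator_iff measurableSet_Ioi, ← Ioc_union_Ioi_eq_Ioi zero_le_one]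
    exact h1.union h2
  exact h3.add h3.comp_neg

namespace LipschitzJordanDomain
variable {Ω : Set ℂ} {γ : ℝ → ℂ}

theorem kernel_bound (h : LipschitzJordanDomain Ω γ) {a : ℝ} (ha0 : 0 < a) (ha1 : a < 1) :
    ∃ M : ℝ, 0 ≤ M ∧ ∀ s ∈ Icc (0:ℝ) 1, ∀ d : ℝ, 0 < d → ∃ κ : ℝ → ℝ, Integrable κ pm ∧
      ∫ t, κ t ∂pm ≤ M * d ^ a ∧ ∀ t ∈ Ioo (0:ℝ) 1, t ≠ s → 0 < ‖γ t - γ s‖ ∧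
        kern a d ‖γ t - γ s‖ ≤ κ t := by
  obtain ⟨c, hc, hbi⟩ := h.biLip
  have hI := kline_integrable ha0 ha1
  refine ⟨3 * c⁻¹ * ∫ x, kline a x, by
    have : 0 ≤ ∫ x, kline a x :=
      MeasureTheory.integral_nonneg (f := kline a) (fun x => kline_nonneg a x)
    positivity, fun s hs d hd => ?_⟩
  have hcd : c / d ≠ 0 := by positivity
  have hd1 : 0 < d ^ (a - 1) := by positivity
  set k : ℝ → ℝ → ℝ := fun y t => kline a (c / d * (t - y)) with hk
  have hki : ∀ y, Integrable (k y) := fun y => (hI.comp_mul_left' hcd).comp_sub_right y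
  have hkint : ∀ y, ∫ t, k y t = d / c * ∫ x, kline a x := by
    intro y
    have h1 : ∫ t, k y t = ∫ t, kline a (c / d * t) :=
      integral_sub_right_eq_self (fun t => kline a (c / d * t)) y
    rw [h1, Measure.integral_comp_mul_left, smul_eq_mul, abs_of_pos (by positivity), inv_div]
  have hkn : ∀ y t, 0 ≤ k y t := fun y t => kline_nonneg _ _
  set κ : ℝ → ℝ := fun t => d ^ (a - 1) * (k s t + k (s + 1) t + k (s - 1) t) with hκ
  have hκi : Integrable κ := (((hki s).add (hki (s + 1))).add (hki (s - 1))).const_mul _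
  refine ⟨κ, hκi.restrict, ?_, ?_⟩
  · calc ∫ t, κ t ∂pm ≤ ∫ t, κ t := by
          refine setIntegral_le_integral hκi (Eventually.of_forall fun t => ?_)
          exact mul_nonneg hd1.le (add_nonneg (add_nonneg (hkn _ _) (hkn _ _)) (hkn _ _))
      _ = d ^ (a - 1) * (3 * (d / c * ∫ x, kline a x)) := by
          simp only [hκ]
          have hi2 : Integrable (fun t => k s t + k (s + 1) t) := (hki s).add (hki (s + 1))
          rw [integral_const_mul, integral_add hi2 (hki (s - 1)),
            integral_add (hki s) (hki (s + 1)), hkint, hkint, hkint]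
          ring
      _ = 3 * c⁻¹ * (∫ x, kline a x) * d ^ a := by
          rw [Real.rpow_sub_one hd.ne']
          field_simp
      _ ≤ _ := le_rfl
  · intro t ht hts
    have hb := hbi t (Ioo_subset_Icc_self ht) s hs
    rw [dist_eq_norm] at hb
    have hx : ∀ y, t ≠ y → d ^ (a - 1) * k y t = kern a d (c * |t - y|) := by
      intro y hy
      have hty : t - y ≠ 0 := sub_ne_zero.2 hy
      have h1 : 0 < |t - y| := abs_pos.2 hty
      simp only [hk]
      rw [kline_eq (mul_ne_zero hcd hty), kern_scale hd (mul_pos hc h1), abs_mul,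
        abs_of_pos (by positivity : 0 < c / d)]
      congr 2
      ring
    have hts' : |t - s| < 1 := by
      rw [abs_lt]; constructor <;> linarith [ht.1, ht.2, hs.1, hs.2]
    have hpos : 0 < min |t - s| (1 - |t - s|) :=
      lt_min (abs_pos.2 (sub_ne_zero.2 hts)) (by linarith)
    have hρ : 0 < ‖γ t - γ s‖ := lt_of_lt_of_le (mul_pos hc hpos) hb
    refine ⟨hρ, (kern_anti ha1 hd (mul_pos hc hpos) hb).trans ?_⟩
    have e : κ t = d ^ (a - 1) * k s t + d ^ (a - 1) * k (s + 1) t + d ^ (a - 1) * k (s - 1) t := by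
      simp only [hκ]; ring
    have n1 := mul_nonneg hd1.le (hkn s t)
    have n2 := mul_nonneg hd1.le (hkn (s + 1) t)
    have n3 := mul_nonneg hd1.le (hkn (s - 1) t)
    rw [e]
    rcases min_choice |t - s| (1 - |t - s|) with h1 | h1
    · rw [h1, ← hx s hts]; linarith
    · rw [h1]
      rcases le_total s t with h2 | h2
      · have : 1 - |t - s| = |t - (s + 1)| := by
          rw [abs_of_nonneg (by linarith), abs_of_nonpos (by linarith [ht.2, hs.1])]; ring
        rw [this, ← hx (s + 1) (by linarith [ht.2, hs.1])]; linarith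
      · have : 1 - |t - s| = |t - (s - 1)| := by
          rw [abs_of_nonpos (by linarith), abs_of_nonneg (by linarith [ht.1, hs.2])]; ring
        rw [this, ← hx (s - 1) (by linarith [ht.1, hs.2])]; linarith

end LipschitzJordanDomain

theorem real_key1 {a c0 d D ρ : ℝ} (hc : 0 < c0) (hd : 0 < d) (hρ : 0 < ρ) (hD : c0 * d ≤ D)
    (hρD : ρ ≤ D + d) : ρ ^ a * (d / (D * ρ)) ≤ (1 + 1 / c0) * kern a d ρ := by
  have hD0 : 0 < D := lt_of_lt_of_le (by positivity) hD
  have e : ρ ^ a * (d / (D * ρ)) = ρ ^ (a - 1) * (d / D) := by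
    rw [Real.rpow_sub_one hρ.ne']; field_simp
  have hdD : d / D ≤ 1 / c0 := by
    rw [div_le_div_iff₀ hD0 hc]; linarith
  have h1 : d / D ≤ (1 + 1 / c0) * min 1 (d / ρ) := by
    rw [mul_min_of_nonneg _ _ (by positivity)]
    refine le_min (by linarith) ?_
    have h3 : ρ ≤ (1 + 1 / c0) * D := by
      have : d ≤ 1 / c0 * D := by
        rw [div_mul_eq_mul_div, le_div_iff₀ hc]; linarith
      linarith
    rw [div_le_iff₀ hD0]
    calc d = d / ρ * ρ := by field_simp
      _ ≤ d / ρ * ((1 + 1 / c0) * D) := by gcongr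
      _ = _ := by ring
  rw [e]
  unfold kern
  calc _ ≤ ρ ^ (a - 1) * ((1 + 1 / c0) * min 1 (d / ρ)) := by gcongr
    _ = _ := by ring

theorem real_key2 {a d D ρ : ℝ} (hd : 0 < d) (hρ : 0 < ρ) (hD : d ≤ D)
    (hρD : ρ ≤ D + d) : ρ ^ a * (1 / D ^ 2) ≤ 4 / d * kern a d ρ := by
  have hD0 : 0 < D := lt_of_lt_of_le hd hD
  have e : ρ ^ a * (1 / D ^ 2) = ρ ^ (a - 1) * (ρ / D ^ 2) := by
    rw [Real.rpow_sub_one hρ.ne']; field_simp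
  have h1 : ρ / D ^ 2 ≤ 4 / d * min 1 (d / ρ) := by
    rw [mul_min_of_nonneg _ _ (by positivity)]
    refine le_min ?_ ?_
    · rw [mul_one, div_le_div_iff₀ (by positivity) hd]
      nlinarith
    · have : 4 / d * (d / ρ) = 4 / ρ := by field_simp
      rw [this, div_le_div_iff₀ (by positivity) hρ]
      nlinarith
  rw [e]
  unfold kern
  calc _ ≤ ρ ^ (a - 1) * (4 / d * min 1 (d / ρ)) := by gcongr
    _ = _ := by ring

/-- Cauchy integral. -/
def cauI (γ : ℝ → ℂ) (u : ℂ → ℂ) (z : ℂ) : ℂ := ∫ t, u (γ t) * deriv γ t / (γ t - z) ∂pm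

/-- Regularised Cauchy integral. -/
def regI (γ : ℝ → ℂ) (u : ℂ → ℂ) (q z : ℂ) : ℂ :=
  ∫ t, (u (γ t) - u q) * deriv γ t / (γ t - z) ∂pm

theorem pm_ae (s : ℝ) : ∀ᵐ t ∂pm, t ∈ Ioo (0:ℝ) 1 ∧ t ≠ s := by
  have h1 : ∀ᵐ t ∂pm, t ∈ Ioo (0:ℝ) 1 := ae_restrict_mem measurableSet_Ioo
  have h2 : ∀ᵐ t ∂pm, t ≠ s := ae_restrict_of_ae (compl_mem_ae_iff.2 (measure_singleton s))
  exact h1.and h2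

namespace LipschitzJordanDomain
variable {Ω : Set ℂ} {γ : ℝ → ℂ}

theorem mul_int (h : LipschitzJordanDomain Ω γ) {u : ℂ → ℂ} (huc : ContinuousOn u (frontier Ω))
    (v : ℂ) : Integrable (fun t => (u (γ t) - v) * deriv γ t) pm := by
  have hc : ContinuousOn (fun t => u (γ t) - v) (Icc 0 1) :=
    (huc.comp h.contOn fun t ht => h.mem_frontier ht).sub continuousOn_const
  obtain ⟨B, hB⟩ := isCompact_Icc.exists_bound_of_continuousOn hc
  refine h.deriv_int.bdd_mul (c := B) ?_ ?_
  · exact (hc.mono Ioo_subset_Icc_self).aestronglyMeasurable measurableSet_Ioo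
  · filter_upwards [pm_ae 0] with t ht using hB t (Ioo_subset_Icc_self ht.1)

theorem div_int (h : LipschitzJordanDomain Ω γ) {m : ℝ → ℂ} (hm : Integrable m pm) {z : ℂ}
    (hz : z ∉ frontier Ω) : Integrable (fun t => m t / (γ t - z)) pm := by
  obtain ⟨r, hr, hh⟩ := h.off hz
  simp_rw [div_eq_mul_inv]
  refine hm.mul_bdd (c := r⁻¹) ?_ ?_
  · exact (h.aesm.sub aestronglyMeasurable_const).inv₀
  · filter_upwards [pm_ae 0] with t ht
    rw [norm_inv]
    exact inv_anti₀ hr (hh t (Ioo_subset_Icc_self ht.1))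

theorem regI_eq (h : LipschitzJordanDomain Ω γ) {u : ℂ → ℂ} (huc : ContinuousOn u (frontier Ω))
    (q : ℂ) {z : ℂ} (hz : z ∉ frontier Ω) :
    regI γ u q z = cauI γ u z - u q * ∫ t, deriv γ t / (γ t - z) ∂pm := by
  unfold regI cauI
  have h1 : Integrable (fun t => u (γ t) * deriv γ t / (γ t - z)) pm := by
    have := h.div_int (h.mul_int huc 0) hz
    simpa using this
  rw [← integral_const_mul, ← integral_sub h1 ((h.div_int h.deriv_int hz).const_mul _)]
  congr 1
  ext t
  ring

theorem reg_int (h : LipschitzJordanDomain Ω γ) {u : ℂ → ℂ} (huc : ContinuousOn u (frontier Ω))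
    {a C : ℝ} (ha0 : 0 < a) (ha1 : a < 1)
    (hu : ∀ x ∈ frontier Ω, ∀ y ∈ frontier Ω, ‖u x - u y‖ ≤ C * ‖x - y‖ ^ a)
    (hC : 0 ≤ C) {q : ℂ} (hq : q ∈ frontier Ω) :
    Integrable (fun t => (u (γ t) - u q) * deriv γ t / (γ t - q)) pm := by
  obtain ⟨M, hM, hk⟩ := h.kernel_bound ha0 ha1
  obtain ⟨K, hK, hd⟩ := h.deriv_bound
  obtain ⟨B, hB⟩ := Metric.isBounded_iff.1 h.frontier_compact.isBounded
  have hq' := hq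
  rw [← h.image] at hq'
  obtain ⟨s, hs, rfl⟩ := hq'
  obtain ⟨κ, hκ, -, hκb⟩ := hk s hs (max B 1) (by positivity)
  refine (hκ.const_mul (C * K)).mono' ?_ ?_
  · simp_rw [div_eq_mul_inv]
    exact (h.mul_int huc _).aestronglyMeasurable.mul
      (h.aesm.sub aestronglyMeasurable_const).inv₀
  · filter_upwards [pm_ae s] with t ht
    obtain ⟨hρ, hb⟩ := hκb t ht.1 ht.2
    have htf := h.mem_frontier (Ioo_subset_Icc_self ht.1)
    have hρB : ‖γ t - γ s‖ ≤ max B 1 := by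
      rw [← dist_eq_norm]; exact (hB htf hq).trans (le_max_left _ _)
    rw [kern, min_eq_left ((one_le_div hρ).2 hρB), mul_one] at hb
    rw [norm_div, norm_mul]
    calc _ ≤ (C * ‖γ t - γ s‖ ^ a) * K / ‖γ t - γ s‖ := by
          gcongr
          · exact hu _ htf _ hq
          · exact hd t ht.1
      _ = C * K * ‖γ t - γ s‖ ^ (a - 1) := by
          rw [Real.rpow_sub_one hρ.ne']; ring
      _ ≤ _ := by gcongr

theorem lemA (h : LipschitzJordanDomain Ω γ) {u : ℂ → ℂ} (huc : ContinuousOn u (frontier Ω))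
    {a C : ℝ} (ha0 : 0 < a) (ha1 : a < 1)
    (hu : ∀ x ∈ frontier Ω, ∀ y ∈ frontier Ω, ‖u x - u y‖ ≤ C * ‖x - y‖ ^ a)
    (hC : 0 ≤ C) {c0 : ℝ} (hc0 : 0 < c0) :
    ∃ A : ℝ, 0 ≤ A ∧ ∀ q ∈ frontier Ω, ∀ z, z ∉ frontier Ω →
      (∀ x ∈ frontier Ω, c0 * ‖z - q‖ ≤ ‖x - z‖) →
      ‖regI γ u q z - regI γ u q q‖ ≤ A * ‖z - q‖ ^ a := by
  obtain ⟨M, hM, hk⟩ := h.kernel_bound ha0 ha1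
  obtain ⟨K, hK, hd⟩ := h.deriv_bound
  refine ⟨C * K * (1 + 1 / c0) * M, by positivity, fun q hq z hz hzc => ?_⟩
  have hdz : 0 < ‖z - q‖ := norm_pos_iff.2 (sub_ne_zero.2 fun e => hz (e ▸ hq))
  have hintg := h.reg_int huc ha0 ha1 hu hC hq
  have hq' := hq
  rw [← h.image] at hq'
  obtain ⟨s, hs, rfl⟩ := hq'
  obtain ⟨κ, hκ, hκM, hκb⟩ := hk s hs _ hdz
  unfold regI
  rw [← integral_sub (h.div_int (h.mul_int huc _) hz) hintg]
  refine (norm_integral_le_of_norm_le (hκ.const_mul (C * K * (1 + 1 / c0))) ?_).trans ?_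
  · filter_upwards [pm_ae s] with t ht
    obtain ⟨hρ, hb⟩ := hκb t ht.1 ht.2
    have htf := h.mem_frontier (Ioo_subset_Icc_self ht.1)
    have hD := hzc _ htf
    have hD0 : 0 < ‖γ t - z‖ := lt_of_lt_of_le (by positivity) hD
    have e : (u (γ t) - u (γ s)) * deriv γ t / (γ t - z) -
        (u (γ t) - u (γ s)) * deriv γ t / (γ t - γ s) =
        (u (γ t) - u (γ s)) * deriv γ t * ((z - γ s) / ((γ t - z) * (γ t - γ s))) := by
      have h1 := norm_pos_iff.1 hD0
      have h2 := norm_pos_iff.1 hρ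
      field_simp
      ring
    rw [e, norm_mul, norm_mul, norm_div, norm_mul]
    have k1 := real_key1 (a := a) hc0 hdz hρ hD (by
      calc ‖γ t - γ s‖ = ‖(γ t - z) + (z - γ s)‖ := by ring_nf
        _ ≤ _ := norm_add_le _ _)
    calc _ ≤ (C * ‖γ t - γ s‖ ^ a) * K * (‖z - γ s‖ / (‖γ t - z‖ * ‖γ t - γ s‖)) := by
          gcongr
          · exact hu _ htf _ hq
          · exact hd t ht.1
      _ = C * K * (‖γ t - γ s‖ ^ a * (‖z - γ s‖ / (‖γ t - z‖ * ‖γ t - γ s‖))) := by ring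
      _ ≤ C * K * ((1 + 1 / c0) * κ t) := by
          refine mul_le_mul_of_nonneg_left (k1.trans ?_) (by positivity)
          exact mul_le_mul_of_nonneg_left hb (by positivity)
      _ = _ := by ring
  · rw [integral_const_mul, mul_assoc _ M]
    exact mul_le_mul_of_nonneg_left hκM (by positivity)

theorem lemB (h : LipschitzJordanDomain Ω γ) {u : ℂ → ℂ} (huc : ContinuousOn u (frontier Ω))
    {a C : ℝ} (ha0 : 0 < a) (ha1 : a < 1)
    (hu : ∀ x ∈ frontier Ω, ∀ y ∈ frontier Ω, ‖u x - u y‖ ≤ C * ‖x - y‖ ^ a)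
    (hC : 0 ≤ C) :
    ∃ A : ℝ, 0 ≤ A ∧ ∀ q ∈ frontier Ω, ∀ z, z ∉ frontier Ω → ∀ w, w ∉ frontier Ω →
      (∀ x ∈ frontier Ω, ‖z - q‖ ≤ ‖x - z‖) → ‖z - w‖ ≤ ‖z - q‖ / 2 →
      ‖regI γ u q z - regI γ u q w‖ ≤ A * ‖z - w‖ ^ a := by
  obtain ⟨M, hM, hk⟩ := h.kernel_bound ha0 ha1
  obtain ⟨K, hK, hd⟩ := h.deriv_bound
  refine ⟨8 * C * K * M, by positivity, fun q hq z hz w hw hzc hzw => ?_⟩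
  have hdz : 0 < ‖z - q‖ := norm_pos_iff.2 (sub_ne_zero.2 fun e => hz (e ▸ hq))
  have hq' := hq
  rw [← h.image] at hq'
  obtain ⟨s, hs, rfl⟩ := hq'
  obtain ⟨κ, hκ, hκM, hκb⟩ := hk s hs _ hdz
  set d := ‖z - γ s‖ with hdd
  unfold regI
  rw [← integral_sub (h.div_int (h.mul_int huc _) hz) (h.div_int (h.mul_int huc _) hw)]
  refine (norm_integral_le_of_norm_le (hκ.const_mul (C * K * (8 * ‖z - w‖ / d))) ?_).trans ?_
  · filter_upwards [pm_ae s] with t ht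
    obtain ⟨hρ, hb⟩ := hκb t ht.1 ht.2
    have htf := h.mem_frontier (Ioo_subset_Icc_self ht.1)
    have hD := hzc _ htf
    have hD0 : 0 < ‖γ t - z‖ := lt_of_lt_of_le (by positivity) hD
    have hW : ‖γ t - z‖ / 2 ≤ ‖γ t - w‖ := by
      have : ‖γ t - z‖ ≤ ‖γ t - w‖ + ‖z - w‖ := by
        calc ‖γ t - z‖ = ‖(γ t - w) - (z - w)‖ := by ring_nf
          _ ≤ _ := norm_sub_le _ _
      linarith
    have hW0 : 0 < ‖γ t - w‖ := lt_of_lt_of_le (by positivity) hW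
    have e : (u (γ t) - u (γ s)) * deriv γ t / (γ t - z) -
        (u (γ t) - u (γ s)) * deriv γ t / (γ t - w) =
        (u (γ t) - u (γ s)) * deriv γ t * ((z - w) / ((γ t - z) * (γ t - w))) := by
      have h1 := norm_pos_iff.1 hD0
      have h2 := norm_pos_iff.1 hW0
      field_simp
      ring
    rw [e, norm_mul, norm_mul, norm_div, norm_mul]
    have k1 := real_key2 (a := a) hdz hρ hD (by
      calc ‖γ t - γ s‖ = ‖(γ t - z) + (z - γ s)‖ := by ring_nf
        _ ≤ _ := norm_add_le _ _)
    calc _ ≤ (C * ‖γ t - γ s‖ ^ a) * K * (‖z - w‖ / (‖γ t - z‖ * (‖γ t - z‖ / 2))) := by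
          gcongr
          · exact hu _ htf _ hq
          · exact hd t ht.1
      _ = C * K * (2 * ‖z - w‖) * (‖γ t - γ s‖ ^ a * (1 / ‖γ t - z‖ ^ 2)) := by
          field_simp
      _ ≤ C * K * (2 * ‖z - w‖) * (4 / d * κ t) := by
          refine mul_le_mul_of_nonneg_left (k1.trans ?_) (by positivity)
          exact mul_le_mul_of_nonneg_left hb (by positivity)
      _ = _ := by ring
  · rw [integral_const_mul]
    have hx : ‖z - w‖ * d ^ (a - 1) ≤ ‖z - w‖ ^ a := by
      rcases (norm_nonneg (z - w)).eq_or_lt with h0 | h0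
      · rw [← h0, zero_mul, Real.zero_rpow ha0.ne']
      · have : d ^ (a - 1) ≤ ‖z - w‖ ^ (a - 1) :=
          Real.rpow_le_rpow_of_nonpos h0 (by linarith) (by linarith)
        calc _ ≤ ‖z - w‖ * ‖z - w‖ ^ (a - 1) := by gcongr
          _ = _ := by rw [Real.rpow_sub_one h0.ne']; field_simp
    calc _ ≤ C * K * (8 * ‖z - w‖ / d) * (M * d ^ a) := by gcongr
      _ = 8 * C * K * M * (‖z - w‖ * d ^ (a - 1)) := by
          rw [Real.rpow_sub_one hdz.ne']; ring
      _ ≤ _ := by gcongr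

end LipschitzJordanDomain

open Classical in
/-- Boundary-extended Cauchy integral from one side. -/
def sideF (Γ : Set ℂ) (γ : ℝ → ℂ) (u : ℂ → ℂ) (ε : ℂ) (z : ℂ) : ℂ :=
  if z ∈ Γ then ε * u z + regI γ u z z else cauI γ u z

theorem scale_rpow {a k x y : ℝ} (ha : 0 < a) (hx : 0 ≤ x) (hk : 0 ≤ k) (hy : 0 ≤ y)
    (h : x ≤ k * y) : x ^ a ≤ k ^ a * y ^ a := by
  rw [← Real.mul_rpow hk hy]
  exact Real.rpow_le_rpow hx h ha.le

namespace LipschitzJordanDomain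
variable {Ω : Set ℂ} {γ : ℝ → ℂ}

theorem holder_side (h : LipschitzJordanDomain Ω γ) {u : ℂ → ℂ}
    (huc : ContinuousOn u (frontier Ω)) {a C : ℝ} (ha0 : 0 < a) (ha1 : a < 1)
    (hu : ∀ x ∈ frontier Ω, ∀ y ∈ frontier Ω, ‖u x - u y‖ ≤ C * ‖x - y‖ ^ a)
    (hC : 0 ≤ C) {Q : Set ℂ} (hQ : Q ⊆ (frontier Ω)ᶜ) {z0 : ℂ} (hz0 : z0 ∈ Q) {ε : ℂ}
    (hε : ∀ z ∈ Q, ∫ t, deriv γ t / (γ t - z) ∂pm = ε)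
    (hcork : ∃ r > 0, ∃ c > 0, ∀ p ∈ frontier Ω, ∀ δ : ℝ, 0 < δ → δ < r →
      ∃ z ∈ Q, ‖z - p‖ ≤ δ ∧ ∀ x ∈ frontier Ω, c * δ ≤ ‖x - z‖) :
    ∃ A : ℝ, 0 ≤ A ∧ ∀ z ∈ Q ∪ frontier Ω, ∀ w ∈ Q ∪ frontier Ω,
      ‖sideF (frontier Ω) γ u ε z - sideF (frontier Ω) γ u ε w‖ ≤ A * ‖z - w‖ ^ a := by
  set G := sideF (frontier Ω) γ u ε with hG
  have e1 : ∀ z ∈ Q, ∀ q ∈ frontier Ω, G z - G q = regI γ u q z - regI γ u q q := by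
    intro z hz q hq
    have hzf := hQ hz
    rw [h.regI_eq huc q hzf, hε z hz]
    simp only [hG, sideF, if_neg hzf, if_pos hq]
    ring
  have e2 : ∀ z ∈ Q, ∀ w ∈ Q, ∀ q, G z - G w = regI γ u q z - regI γ u q w := by
    intro z hz w hw q
    have hzf := hQ hz
    have hwf := hQ hw
    rw [h.regI_eq huc q hzf, hε z hz, h.regI_eq huc q hwf, hε w hw]
    simp only [hG, sideF, if_neg hzf, if_neg hwf]
    ring
  have cone : ∀ c0 : ℝ, 0 < c0 → ∃ A : ℝ, 0 ≤ A ∧ ∀ q ∈ frontier Ω, ∀ z ∈ Q,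
      (∀ x ∈ frontier Ω, c0 * ‖z - q‖ ≤ ‖x - z‖) → ‖G z - G q‖ ≤ A * ‖z - q‖ ^ a := by
    intro c0 hc0
    obtain ⟨A, hA, hh⟩ := h.lemA huc ha0 ha1 hu hC hc0
    refine ⟨A, hA, fun q hq z hz hx => ?_⟩
    rw [e1 z hz q hq]
    exact hh q hq z (hQ hz) hx
  obtain ⟨B, hB0, hB⟩ : ∃ B : ℝ, 0 ≤ B ∧ ∀ q ∈ frontier Ω, ‖G z0 - G q‖ ≤ B := by
    have hr0 := (isClosed_frontier.notMem_iff_infDist_pos h.frontier_nonempty).1 (hQ hz0)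
    obtain ⟨R, hR⟩ := h.frontier_compact.isBounded.subset_closedBall z0
    set R' := max R 1
    have hR' : 0 < R' := by positivity
    obtain ⟨A, hA, hh⟩ := cone (infDist z0 (frontier Ω) / R') (by positivity)
    refine ⟨A * R' ^ a, by positivity, fun q hq => ?_⟩
    have hqR : ‖z0 - q‖ ≤ R' := by
      rw [← dist_eq_norm, dist_comm]; exact (hR hq).trans (le_max_left _ _)
    refine (hh q hq z0 hz0 fun x hx => ?_).trans ?_
    · calc _ ≤ infDist z0 (frontier Ω) / R' * R' := by gcongr
        _ = infDist z0 (frontier Ω) := by field_simp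
        _ ≤ dist z0 x := infDist_le_dist_of_mem hx
        _ = _ := by rw [dist_comm, dist_eq_norm]
    · gcongr
  obtain ⟨A2, hA2, hΓΓ⟩ : ∃ A : ℝ, 0 ≤ A ∧ ∀ q ∈ frontier Ω, ∀ p ∈ frontier Ω,
      ‖G q - G p‖ ≤ A * ‖q - p‖ ^ a := by
    obtain ⟨r, hr, c, hc, hcork⟩ := hcork
    obtain ⟨A, hA, hh⟩ := cone (c / 2) (by positivity)
    refine ⟨2 * A * 2 ^ a + 2 * B / r ^ a, by positivity, fun q hq p hp => ?_⟩
    have hδ := norm_nonneg (q - p)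
    set δ := ‖q - p‖ with hδd
    have hra : 0 < r ^ a := by positivity
    rcases hδ.eq_or_lt with h0 | h0
    · have : q = p := sub_eq_zero.1 (norm_eq_zero.1 h0.symm)
      rw [this, sub_self, norm_zero]; positivity
    rcases lt_or_ge δ r with h1 | h1
    · obtain ⟨z, hz, hzq, hzx⟩ := hcork q hq δ h0 h1
      have hzp : ‖z - p‖ ≤ 2 * δ := by
        calc ‖z - p‖ = ‖(z - q) + (q - p)‖ := by ring_nf
          _ ≤ ‖z - q‖ + ‖q - p‖ := norm_add_le _ _
          _ ≤ _ := by linarith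
      have b1 := hh q hq z hz fun x hx => le_trans (by nlinarith) (hzx x hx)
      have b2 := hh p hp z hz fun x hx => le_trans (by nlinarith) (hzx x hx)
      have s1 := scale_rpow ha0 (norm_nonneg (z - q)) zero_le_two hδ (by linarith)
      have s2 := scale_rpow ha0 (norm_nonneg (z - p)) zero_le_two hδ hzp
      calc ‖G q - G p‖ = ‖(G z - G p) - (G z - G q)‖ := by ring_nf
        _ ≤ ‖G z - G p‖ + ‖G z - G q‖ := norm_sub_le _ _
        _ ≤ A * (2 ^ a * δ ^ a) + A * (2 ^ a * δ ^ a) := by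
            refine add_le_add (b2.trans ?_) (b1.trans ?_) <;> gcongr
        _ = 2 * A * 2 ^ a * δ ^ a := by ring
        _ ≤ _ := by
            gcongr
            have : 0 ≤ 2 * B / r ^ a := by positivity
            linarith
    · have hra2 : r ^ a ≤ δ ^ a := Real.rpow_le_rpow hr.le h1 ha0.le
      calc ‖G q - G p‖ = ‖(G z0 - G p) - (G z0 - G q)‖ := by ring_nf
        _ ≤ ‖G z0 - G p‖ + ‖G z0 - G q‖ := norm_sub_le _ _
        _ ≤ 2 * B := by linarith [hB q hq, hB p hp]
        _ = 2 * B / r ^ a * r ^ a := by field_simp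
        _ ≤ 2 * B / r ^ a * δ ^ a := by gcongr
        _ ≤ _ := by
            gcongr
            have : 0 ≤ 2 * A * 2 ^ a := by positivity
            linarith
  obtain ⟨A1, hA1, hh1⟩ := cone 1 one_pos
  have nearest : ∀ z ∈ Q ∪ frontier Ω, ∃ q ∈ frontier Ω,
      (∀ x ∈ frontier Ω, ‖z - q‖ ≤ ‖x - z‖) ∧ ‖G z - G q‖ ≤ A1 * ‖z - q‖ ^ a := by
    rintro z (hz | hz)
    · obtain ⟨q, hq, hqe⟩ := h.frontier_compact.exists_infDist_eq_dist h.frontier_nonempty z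
      have hn : ∀ x ∈ frontier Ω, ‖z - q‖ ≤ ‖x - z‖ := by
        intro x hx
        rw [← dist_eq_norm, ← dist_eq_norm, ← hqe, dist_comm x z]
        exact infDist_le_dist_of_mem hx
      exact ⟨q, hq, hn, hh1 q hq z hz (by simpa using hn)⟩
    · refine ⟨z, hz, fun x _ => by simp, ?_⟩
      rw [sub_self, norm_zero]; positivity
  obtain ⟨A3, hA3, hh3⟩ := h.lemB huc ha0 ha1 hu hC
  have near : ∀ z ∈ Q ∪ frontier Ω, ∀ w ∈ Q ∪ frontier Ω, ∀ q ∈ frontier Ω,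
      (∀ x ∈ frontier Ω, ‖z - q‖ ≤ ‖x - z‖) → ‖z - w‖ ≤ ‖z - q‖ / 2 →
      ‖G z - G w‖ ≤ A3 * ‖z - w‖ ^ a := by
    intro z hz w hw q hq hn hzw
    have triv : z = w → ‖G z - G w‖ ≤ A3 * ‖z - w‖ ^ a := by
      rintro rfl
      rw [sub_self, norm_zero]; positivity
    have small : ‖z - q‖ ≤ 0 → ‖G z - G w‖ ≤ A3 * ‖z - w‖ ^ a := fun h0 =>
      triv (sub_eq_zero.1 (norm_le_zero_iff.1 (by linarith)))
    rcases hz with hz | hz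
    · rcases hw with hw | hw
      · rw [e2 z hz w hw q]
        exact hh3 q hq z (hQ hz) w (hQ hw) hn hzw
      · refine small ?_
        have := hn w hw
        rw [norm_sub_rev w z] at this
        linarith
    · refine small ?_
      have := hn z hz
      simpa using this
  refine ⟨A3 + (2 * A1 + A2) * 5 ^ a, by positivity, fun z hz w hw => ?_⟩
  have hδ := norm_nonneg (z - w)
  have hδa : 0 ≤ ‖z - w‖ ^ a := by positivity
  have hc1 : A3 * ‖z - w‖ ^ a ≤ (A3 + (2 * A1 + A2) * 5 ^ a) * ‖z - w‖ ^ a := by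
    gcongr
    have : 0 ≤ (2 * A1 + A2) * 5 ^ a := by positivity
    linarith
  obtain ⟨q, hq, hqn, hqG⟩ := nearest z hz
  obtain ⟨p, hp, hpn, hpG⟩ := nearest w hw
  rcases le_or_gt ‖z - w‖ (‖z - q‖ / 2) with h1 | h1
  · exact (near z hz w hw q hq hqn h1).trans hc1
  rcases le_or_gt ‖z - w‖ (‖w - p‖ / 2) with h2 | h2
  · have := near w hw z hz p hp hpn (by rwa [norm_sub_rev])
    rw [norm_sub_rev (G w), norm_sub_rev w] at this
    exact this.trans hc1
  have hqp : ‖q - p‖ ≤ 5 * ‖z - w‖ := by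
    calc ‖q - p‖ = ‖(z - w) - (z - q) + (w - p)‖ := by ring_nf
      _ ≤ ‖z - w‖ + ‖z - q‖ + ‖w - p‖ :=
        (norm_add_le _ _).trans (add_le_add (norm_sub_le _ _) le_rfl)
      _ ≤ _ := by linarith
  have s1 := scale_rpow ha0 (norm_nonneg (z - q)) (by norm_num : (0:ℝ) ≤ 5) hδ (by linarith)
  have s2 := scale_rpow ha0 (norm_nonneg (w - p)) (by norm_num : (0:ℝ) ≤ 5) hδ (by linarith)
  have s3 := scale_rpow ha0 (norm_nonneg (q - p)) (by norm_num : (0:ℝ) ≤ 5) hδ hqp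
  calc ‖G z - G w‖ = ‖(G z - G q) + (G q - G p) - (G w - G p)‖ := by ring_nf
    _ ≤ ‖G z - G q‖ + ‖G q - G p‖ + ‖G w - G p‖ :=
      (norm_sub_le _ _).trans (add_le_add (norm_add_le _ _) le_rfl)
    _ ≤ A1 * (5 ^ a * ‖z - w‖ ^ a) + A2 * (5 ^ a * ‖z - w‖ ^ a)
        + A1 * (5 ^ a * ‖z - w‖ ^ a) := by
      refine add_le_add (add_le_add (hqG.trans ?_) ((hΓΓ q hq p hp).trans ?_)) (hpG.trans ?_) <;>
        gcongr
    _ = (2 * A1 + A2) * 5 ^ a * ‖z - w‖ ^ a := by ring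
    _ ≤ _ := by
      gcongr
      linarith

end LipschitzJordanDomain

theorem holder_of_norm {f : ℂ → ℂ} {s : Set ℂ} {A : ℝ} {α : ℝ≥0} (hA : 0 ≤ A)
    (h : ∀ z ∈ s, ∀ w ∈ s, ‖f z - f w‖ ≤ A * ‖z - w‖ ^ (α : ℝ)) :
    HolderOnWith (Real.toNNReal A) α f s := by
  intro z hz w hw
  rw [edist_nndist, edist_nndist, ← ENNReal.coe_rpow_of_nonneg _ α.coe_nonneg,
    ← ENNReal.coe_mul, ENNReal.coe_le_coe, ← NNReal.coe_le_coe]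
  push_cast
  rw [Real.coe_toNNReal A hA, dist_eq_norm, dist_eq_norm]
  exact h z hz w hw

theorem closed_sides (Ω : Set ℂ) (hO : IsOpen Ω) :
    closure Ω = Ω ∪ frontier Ω ∧ Ωᶜ = (closure Ω)ᶜ ∪ frontier Ω := by
  rw [hO.frontier_eq]
  have : Ω ⊆ closure Ω := subset_closure
  constructor
  · ext x
    by_cases hx : x ∈ Ω
    · simp [hx, this hx]
    · simp [hx]
  · ext x
    by_cases hx : x ∈ Ω
    · simp [hx, this hx]
    · simp [hx, em']

namespace LipschitzJordanDomain
variable {Ω : Set ℂ} {γ : ℝ → ℂ}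

theorem sideF_diff (h : LipschitzJordanDomain Ω γ) {u : ℂ → ℂ}
    (huc : ContinuousOn u (frontier Ω)) (ε : ℂ) {z : ℂ} (hz : z ∉ frontier Ω) :
    DifferentiableAt ℂ (sideF (frontier Ω) γ u ε) z := by
  obtain ⟨r, hr, hh⟩ := h.off hz
  have hm : Integrable (fun t => u (γ t) * deriv γ t) pm := by simpa using h.mul_int huc 0
  have hd := cauchy_hasDerivAt hm h.aesm hr (z := z) (by
    filter_upwards [pm_ae 0] with t ht using hh t (Ioo_subset_Icc_self ht.1))
  refine hd.differentiableAt.congr_of_eventuallyEq ?_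
  filter_upwards [isClosed_frontier.isOpen_compl.mem_nhds hz] with w hw
  simp only [sideF]
  rw [if_neg hw]
  rfl

theorem sideF_tendsto (h : LipschitzJordanDomain Ω γ) {u : ℂ → ℂ}
    (huc : ContinuousOn u (frontier Ω)) (ε : ℂ) :
    Tendsto (sideF (frontier Ω) γ u ε) (cocompact ℂ) (𝓝 0) := by
  have hm : Integrable (fun t => u (γ t) * deriv γ t) pm := by simpa using h.mul_int huc 0
  obtain ⟨B, hB⟩ := isCompact_Icc.exists_bound_of_continuousOn h.contOn
  have ht := cauchy_tendsto hm (γ := γ) (B := B) (by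
    filter_upwards [pm_ae 0] with t ht using hB t (Ioo_subset_Icc_self ht.1))
  refine ht.congr' ?_
  filter_upwards [h.frontier_compact.compl_mem_cocompact] with w hw
  simp only [sideF]
  rw [if_neg hw]
  rfl

theorem unique_aux (h : LipschitzJordanDomain Ω γ) {f F : ℂ → ℂ}
    (hf : DifferentiableOn ℂ f Ω) (hfc : ContinuousOn f (closure Ω))
    (hF : DifferentiableOn ℂ F (closure Ω)ᶜ) (hFc : ContinuousOn F Ωᶜ)
    (hF0 : Tendsto F (cocompact ℂ) (𝓝 0)) (he : EqOn f F (frontier Ω)) :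
    EqOn f 0 (closure Ω) ∧ EqOn F 0 Ωᶜ := by
  classical
  obtain ⟨hcl, hco⟩ := closed_sides Ω h.isOpen
  have hcov : closure Ω ∪ Ωᶜ = univ :=
    eq_univ_of_forall fun x => (em (x ∈ Ω)).imp (fun hx => subset_closure hx) id
  set E : ℂ → ℂ := fun z => if z ∈ closure Ω then f z else F z with hE
  have E1 : EqOn E f (closure Ω) := fun z hz => if_pos hz
  have E2 : EqOn E F Ωᶜ := by
    intro z hz
    rw [hco] at hz
    rcases hz with hz | hz
    · exact if_neg hz
    · rw [E1 (frontier_subset_closure hz)]; exact he hz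
  have Ec : Continuous E := by
    rw [← continuousOn_univ, ← hcov]
    exact (hfc.congr E1).union_of_isClosed (hFc.congr E2) isClosed_closure h.isOpen.isClosed_compl
  have Ein : ∀ z ∈ Ω, DifferentiableAt ℂ E z := fun z hz =>
    ((hf z hz).differentiableAt (h.isOpen.mem_nhds hz)).congr_of_eventuallyEq
      (by filter_upwards [h.isOpen.mem_nhds hz] with w hw using E1 (subset_closure hw))
  have Eex : ∀ z ∈ (closure Ω)ᶜ, DifferentiableAt ℂ E z := fun z hz =>
    ((hF z hz).differentiableAt (isClosed_closure.isOpen_compl.mem_nhds hz)).congr_of_eventuallyEq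
      (by filter_upwards [isClosed_closure.isOpen_compl.mem_nhds hz] with w hw using if_neg hw)
  have Ed : Differentiable ℂ E := by
    intro z
    by_cases hz : z ∈ frontier Ω
    · obtain ⟨e, he1, φ, K, hφ, ρ, hρ, hl⟩ := h.local_graph hz
      have := painleve_rot Ec hφ he1 (q := z) (r := ρ) (fun p hp hne => by
        obtain ⟨l1, l2, -⟩ := hl p hp
        rcases lt_or_gt_of_ne hne with h1 | h1
        · exact Eex p (l2 h1)
        · exact Ein p (l1 h1))
      exact (this z (mem_ball_self hρ)).differentiableAt (ball_mem_nhds z hρ)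
    · by_cases hz2 : z ∈ closure Ω
      · rw [hcl] at hz2
        exact Ein z (hz2.resolve_right hz)
      · exact Eex z hz2
  have Et : Tendsto E (cocompact ℂ) (𝓝 0) := by
    refine hF0.congr' ?_
    filter_upwards [h.bounded.isCompact_closure.compl_mem_cocompact] with w hw
    exact (if_neg hw).symm
  have E0 : ∀ z, E z = 0 := fun z => Ed.apply_eq_of_tendsto_cocompact z Et
  exact ⟨fun z hz => by rw [← E1 hz, E0]; rfl, fun z hz => by rw [← E2 hz, E0]; rfl⟩

end LipschitzJordanDomain

/-- **Hölder `h + H` decomposition** (Theorem 1.1 (ii)).  Let `Ω` be a bounded Jordan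
domain with Lipschitz boundary and `0 < α < 1`.  Every `u ∈ C^{0,α}(bΩ)` can be
written uniquely as `u = h + H` on `bΩ`, where `h` is holomorphic on `Ω` and belongs to
`C^{0,α}(Ω̄)`, and `H` is holomorphic on `ℂ ∖ Ω̄`, belongs to `C^{0,α}(ℂ ∖ Ω)`, and
vanishes at infinity. -/
theorem holder_decomposition
    (Ω : Set ℂ) (γ : ℝ → ℂ) (hΩ : LipschitzJordanDomain Ω γ)
    (α : ℝ≥0) (hα0 : 0 < α) (hα1 : α < 1) (u : ℂ → ℂ)
    (hu : ∃ C : ℝ≥0, HolderOnWith C α u (frontier Ω)) :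
    ∃ h H : ℂ → ℂ,
      (DifferentiableOn ℂ h Ω ∧ (∃ C : ℝ≥0, HolderOnWith C α h (closure Ω)) ∧
       DifferentiableOn ℂ H (closure Ω)ᶜ ∧ (∃ C : ℝ≥0, HolderOnWith C α H Ωᶜ) ∧
       Tendsto H (cocompact ℂ) (𝓝 0) ∧
       EqOn u (h + H) (frontier Ω)) ∧
      (∀ h' H' : ℂ → ℂ,
        (DifferentiableOn ℂ h' Ω ∧ (∃ C : ℝ≥0, HolderOnWith C α h' (closure Ω)) ∧
         DifferentiableOn ℂ H' (closure Ω)ᶜ ∧ (∃ C : ℝ≥0, HolderOnWith C α H' Ωᶜ) ∧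
         Tendsto H' (cocompact ℂ) (𝓝 0) ∧
         EqOn u (h' + H') (frontier Ω)) →
        EqOn h h' (closure Ω) ∧ EqOn H H' Ωᶜ) := by
  obtain ⟨C, hC⟩ := hu
  have huc : ContinuousOn u (frontier Ω) := hC.continuousOn hα0
  have hun : ∀ x ∈ frontier Ω, ∀ y ∈ frontier Ω, ‖u x - u y‖ ≤ C * ‖x - y‖ ^ (α : ℝ) := by
    intro x hx y hy
    have := hC.dist_le hx hy
    rwa [dist_eq_norm, dist_eq_norm] at this
  have ha0 : (0:ℝ) < α := by exact_mod_cast hα0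
  have ha1 : (α:ℝ) < 1 := by exact_mod_cast hα1
  obtain ⟨hcl, hco⟩ := closed_sides Ω hΩ.isOpen
  have hpi : (2 * Real.pi * I : ℂ) ≠ 0 := Complex.two_pi_I_ne_zero
  obtain ⟨r, hr, c, hc, hcork⟩ := hΩ.cork
  obtain ⟨z0, hz0⟩ := hΩ.nonempty
  obtain ⟨p0, hp0⟩ := hΩ.frontier_nonempty
  obtain ⟨z1, hz1, -⟩ := (hcork p0 hp0 (r / 2) (by positivity) (by linarith)).2
  obtain ⟨A, hA, hAb⟩ := hΩ.holder_side huc ha0 ha1 hun C.coe_nonneg (LipschitzJordanDomain.Om_sub hΩ) hz0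
    (ε := 2 * Real.pi * I) (fun z hz => by
      have := hΩ.wind_one hz
      field_simp at this
      exact this)
    ⟨r, hr, c, hc, fun p hp δ h0 h1 => (hcork p hp δ h0 h1).1⟩
  obtain ⟨B, hB, hBb⟩ := hΩ.holder_side huc ha0 ha1 hun C.coe_nonneg (LipschitzJordanDomain.ext_sub Ω) hz1
    (ε := 0) (fun z hz => hΩ.wind_zero hz)
    ⟨r, hr, c, hc, fun p hp δ h0 h1 => (hcork p hp δ h0 h1).2⟩
  have hol : ∀ (k : ℂ) (f : ℂ → ℂ) (s : Set ℂ) (A : ℝ), 0 ≤ A →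
      (∀ z ∈ s, ∀ w ∈ s, ‖f z - f w‖ ≤ A * ‖z - w‖ ^ (α : ℝ)) →
      ∃ C : ℝ≥0, HolderOnWith C α (fun z => k * f z) s := by
    intro k f s A hA hf
    refine ⟨_, holder_of_norm (A := ‖k‖ * A) (by positivity) fun z hz w hw => ?_⟩
    rw [← mul_sub, norm_mul, mul_assoc]
    exact mul_le_mul_of_nonneg_left (hf z hz w hw) (norm_nonneg _)
  set k : ℂ := (2 * Real.pi * I)⁻¹ with hk
  set G := sideF (frontier Ω) γ u (2 * Real.pi * I) with hG
  set G' := sideF (frontier Ω) γ u 0 with hG'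
  have hH1 : ∃ C : ℝ≥0, HolderOnWith C α (fun z => k * G z) (closure Ω) := by
    rw [hcl]; exact hol _ _ _ A hA hAb
  have hH2 : ∃ C : ℝ≥0, HolderOnWith C α (fun z => -k * G' z) Ωᶜ := by
    rw [hco]; exact hol _ _ _ B hB hBb
  have hd1 : DifferentiableOn ℂ (fun z => k * G z) Ω := fun z hz =>
    ((hΩ.sideF_diff huc _ (LipschitzJordanDomain.Om_sub hΩ hz)).const_mul k).differentiableWithinAt
  have hd2 : DifferentiableOn ℂ (fun z => -k * G' z) (closure Ω)ᶜ := fun z hz =>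
    ((hΩ.sideF_diff huc _ (LipschitzJordanDomain.ext_sub Ω hz)).const_mul (-k)).differentiableWithinAt
  have ht : Tendsto (fun z => -k * G' z) (cocompact ℂ) (𝓝 0) := by
    simpa using (hΩ.sideF_tendsto huc 0).const_mul (-k)
  have heq : EqOn u ((fun z => k * G z) + fun z => -k * G' z) (frontier Ω) := by
    intro z hz
    simp only [Pi.add_apply, hG, hG', sideF, if_pos hz, hk]
    field_simp
    ring
  refine ⟨_, _, ⟨hd1, hH1, hd2, hH2, ht, heq⟩, ?_⟩
  rintro h' H' ⟨hd1', ⟨C1', hH1'⟩, hd2', ⟨C2', hH2'⟩, ht', heq'⟩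
  obtain ⟨C1, hH1⟩ := hH1
  obtain ⟨C2, hH2⟩ := hH2
  obtain ⟨u1, u2⟩ := hΩ.unique_aux (hd1.sub hd1')
    ((hH1.continuousOn hα0).sub (hH1'.continuousOn hα0)) (hd2'.sub hd2)
    ((hH2'.continuousOn hα0).sub (hH2.continuousOn hα0)) (by
      have := ht'.sub ht
      rw [sub_zero] at this
      exact this) (by
      intro z hz
      have h1 := heq hz
      have h2 := heq' hz
      simp only [Pi.add_apply, Pi.sub_apply] at h1 h2 ⊢
      linear_combination h2 - h1)
  exact ⟨fun z hz => sub_eq_zero.1 (u1 hz), fun z hz => (sub_eq_zero.1 (u2 hz)).symm⟩
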